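/- Let A be a smooth majority free finite idempotent algebra omitting type 1. Then there exist a single ternary term operation m of A and a set U of pairs of elements of A such that m is a Mal'tsev operation on {a,b} for every pair ab in U, and for any two distinct maximal components C1, C2 of Gs(A) there are a in C1 and b in C2 with ab in U. -/

import Mathlib

/-! Common framework: universal algebras over a fixed signature, terms,
subalgebras, congruences, quotients, edges and their types (Bulatov's
coloured-graph approach), thin edges, connectivity, products, etc. -/

/-- A (functional) signature: a type of operation symbols with arities. -/
structure Signature where
  ops : Type
  arity : ops → ℕ

/-- An algebra of a given signature. -/
structure UAlgebra (σ : Signature) where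
  carrier : Type
  interp : ∀ f : σ.ops, (Fin (σ.arity f) → carrier) → carrier

/-- Terms over the signature `σ` in `n` variables. -/
inductive Term (σ : Signature) (n : ℕ) where
  | var : Fin n → Term σ n
  | app : (f : σ.ops) → (Fin (σ.arity f) → Term σ n) → Term σ n

/-- Evaluation of a term in an algebra; term operations of an algebra are
exactly the operations of the form `Term.eval A t`. -/
def Term.eval {σ : Signature} {n : ℕ} (A : UAlgebra σ) :
    Term σ n → (Fin n → A.carrier) → A.carrier
  | .var i, x => x i
  | .app f ts, x => A.interp f fun j => Term.eval A (ts j) x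

namespace UAlgebra

variable {σ : Signature}

/-- An algebra is idempotent if all its basic operations are. -/
def Idempotent (A : UAlgebra σ) : Prop :=
  ∀ (f : σ.ops) (a : A.carrier), A.interp f (fun _ => a) = a

/-- A set closed under all basic operations. -/
def IsClosed (A : UAlgebra σ) (S : Set A.carrier) : Prop :=
  ∀ (f : σ.ops) (x : Fin (σ.arity f) → A.carrier), (∀ j, x j ∈ S) → A.interp f x ∈ S

/-- Closure of a set under the basic operations. -/
inductive Closure (A : UAlgebra σ) (S : Set A.carrier) : A.carrier → Prop
  | base {a : A.carrier} : a ∈ S → Closure A S a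
  | app (f : σ.ops) (x : Fin (σ.arity f) → A.carrier) :
      (∀ j, Closure A S (x j)) → Closure A S (A.interp f x)

def ClosureSet (A : UAlgebra σ) (S : Set A.carrier) : Set A.carrier := {x | Closure A S x}

theorem closureSet_isClosed (A : UAlgebra σ) (S : Set A.carrier) :
    A.IsClosed (A.ClosureSet S) := fun f x h => Closure.app f x h

/-- The subalgebra of `A` on a closed subset `S`. -/
def subalg (A : UAlgebra σ) (S : Set A.carrier) (hS : A.IsClosed S) : UAlgebra σ where
  carrier := {x : A.carrier // x ∈ S}
  interp f x := ⟨A.interp f fun j => (x j : A.carrier), hS f _ fun j => (x j).2⟩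

/-- The subalgebra generated by a set `S`. -/
def Sg (A : UAlgebra σ) (S : Set A.carrier) : UAlgebra σ :=
  A.subalg (A.ClosureSet S) (A.closureSet_isClosed S)

/-- `a` as an element of `Sg {a, b}`. -/
def sgA (A : UAlgebra σ) (a b : A.carrier) : (A.Sg {a, b}).carrier :=
  ⟨a, Closure.base (Set.mem_insert a {b})⟩

/-- `b` as an element of `Sg {a, b}`. -/
def sgB (A : UAlgebra σ) (a b : A.carrier) : (A.Sg {a, b}).carrier :=
  ⟨b, Closure.base (Set.mem_insert_iff.mpr (Or.inr rfl))⟩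

/-- A congruence of an algebra. -/
structure Congruence (A : UAlgebra σ) where
  rel : A.carrier → A.carrier → Prop
  refl : ∀ x, rel x x
  symm : ∀ {x y}, rel x y → rel y x
  trans : ∀ {x y z}, rel x y → rel y z → rel x z
  compat : ∀ (f : σ.ops) (x y : Fin (σ.arity f) → A.carrier),
      (∀ j, rel (x j) (y j)) → rel (A.interp f x) (A.interp f y)

def Congruence.toSetoid {A : UAlgebra σ} (θ : Congruence A) : Setoid A.carrier :=
  ⟨θ.rel, ⟨θ.refl, θ.symm, θ.trans⟩⟩

/-- The full congruence. -/
def Congruence.IsFull {A : UAlgebra σ} (θ : Congruence A) : Prop := ∀ x y, θ.rel x y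

def Congruence.le {A : UAlgebra σ} (θ η : Congruence A) : Prop :=
  ∀ x y, θ.rel x y → η.rel x y

/-- A maximal congruence: proper, and any congruence above it is full or below it. -/
def Congruence.IsMaximal {A : UAlgebra σ} (θ : Congruence A) : Prop :=
  ¬ θ.IsFull ∧ ∀ η : Congruence A, θ.le η → ¬ η.IsFull → η.le θ

/-- The quotient (factor) algebra. -/
noncomputable def quot (A : UAlgebra σ) (θ : Congruence A) : UAlgebra σ where
  carrier := Quotient θ.toSetoid
  interp f x := Quotient.mk θ.toSetoid (A.interp f fun j => (x j).out)

/-- The class of `a` in the quotient of `Sg {a,b}` by `θ`. -/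
def qa (A : UAlgebra σ) (a b : A.carrier) (θ : Congruence (A.Sg {a, b})) :
    ((A.Sg {a, b}).quot θ).carrier :=
  Quotient.mk θ.toSetoid (A.sgA a b)

def qb (A : UAlgebra σ) (a b : A.carrier) (θ : Congruence (A.Sg {a, b})) :
    ((A.Sg {a, b}).quot θ).carrier :=
  Quotient.mk θ.toSetoid (A.sgB a b)

end UAlgebra

/-- A binary operation is a semilattice operation on a set `B`. -/
def IsSemilatticeOn {α : Type} (f : α → α → α) (B : Set α) : Prop :=
  (∀ x ∈ B, f x x = x) ∧ (∀ x ∈ B, ∀ y ∈ B, f x y = f y x) ∧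
    (∀ x ∈ B, ∀ y ∈ B, ∀ z ∈ B, f x (f y z) = f (f x y) z)

/-- A ternary operation is a majority operation on a set `B`. -/
def IsMajorityOn {α : Type} (g : α → α → α → α) (B : Set α) : Prop :=
  ∀ x ∈ B, ∀ y ∈ B, g x x y = x ∧ g x y x = x ∧ g y x x = x

/-- A ternary operation is a Mal'tsev operation on a set `B`. -/
def IsMaltsevOn {α : Type} (h : α → α → α → α) (B : Set α) : Prop :=
  ∀ x ∈ B, ∀ y ∈ B, h x y y = x ∧ h y y x = x

namespace UAlgebra

variable {σ : Signature}

/-- An algebra is "a set": every term operation is a projection. -/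
def IsSetAlgebra (Q : UAlgebra σ) : Prop :=
  ∀ (n : ℕ) (t : Term σ n), ∃ i : Fin n, ∀ x : Fin n → Q.carrier, t.eval Q x = x i

/-- An algebra is the full idempotent reduct of a module over some finite ring:
its term operations are exactly the idempotent affine combinations; in
particular the affine operation `x - y + z` is a term operation. -/
def IsAffineAlgebra (Q : UAlgebra σ) : Prop :=
  ∃ (R : Type) (_ : Ring R) (_ : Finite R) (_ : AddCommGroup Q.carrier)
    (_ : Module R Q.carrier),
    (∀ (n : ℕ) (g : (Fin n → Q.carrier) → Q.carrier),
      (∃ t : Term σ n, ∀ x, t.eval Q x = g x) ↔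
      (∃ c : Fin n → R, (∑ i, c i) = 1 ∧ ∀ x, g x = ∑ i, c i • x i)) ∧
    (∃ t : Term σ 3, ∀ x y z : Q.carrier, t.eval Q ![x, y, z] = x - y + z)

/-- `θ` witnesses that `ab` is an edge of the unary type. -/
def UnaryWitness (A : UAlgebra σ) (a b : A.carrier) (θ : Congruence (A.Sg {a, b})) : Prop :=
  θ.IsMaximal ∧ IsSetAlgebra ((A.Sg {a, b}).quot θ)

/-- `θ` witnesses that `ab` is an edge of the semilattice type. -/
def SLWitness (A : UAlgebra σ) (a b : A.carrier) (θ : Congruence (A.Sg {a, b})) : Prop :=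
  θ.IsMaximal ∧ ∃ t : Term σ 2,
    IsSemilatticeOn (fun x y => t.eval ((A.Sg {a, b}).quot θ) ![x, y])
      {A.qa a b θ, A.qb a b θ}

/-- `θ` witnesses that `ab` is an edge of the majority type. -/
def MajWitness (A : UAlgebra σ) (a b : A.carrier) (θ : Congruence (A.Sg {a, b})) : Prop :=
  θ.IsMaximal ∧
  (∃ t : Term σ 3,
    IsMajorityOn (fun x y z => t.eval ((A.Sg {a, b}).quot θ) ![x, y, z])
      {A.qa a b θ, A.qb a b θ}) ∧
  ¬ (∃ t : Term σ 2,
    IsSemilatticeOn (fun x y => t.eval ((A.Sg {a, b}).quot θ) ![x, y])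
      {A.qa a b θ, A.qb a b θ})

/-- `θ` witnesses that `ab` is an edge of the affine type. -/
def AffWitness (A : UAlgebra σ) (a b : A.carrier) (θ : Congruence (A.Sg {a, b})) : Prop :=
  θ.IsMaximal ∧ IsAffineAlgebra ((A.Sg {a, b}).quot θ)

/-- A pair of distinct elements is an edge. -/
def IsEdge (A : UAlgebra σ) (a b : A.carrier) : Prop :=
  a ≠ b ∧ ∃ θ : Congruence (A.Sg {a, b}), ¬ θ.IsFull ∧
    (IsSetAlgebra ((A.Sg {a, b}).quot θ) ∨
     IsAffineAlgebra ((A.Sg {a, b}).quot θ) ∨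
     (∃ t : Term σ 2,
        IsSemilatticeOn (fun x y => t.eval ((A.Sg {a, b}).quot θ) ![x, y])
          {A.qa a b θ, A.qb a b θ}) ∨
     (∃ t : Term σ 3,
        IsMajorityOn (fun x y z => t.eval ((A.Sg {a, b}).quot θ) ![x, y, z])
          {A.qa a b θ, A.qb a b θ}))

def IsUnaryEdge (A : UAlgebra σ) (a b : A.carrier) : Prop :=
  a ≠ b ∧ ∃ θ : Congruence (A.Sg {a, b}), UnaryWitness A a b θ

def IsSLEdge (A : UAlgebra σ) (a b : A.carrier) : Prop :=
  a ≠ b ∧ ∃ θ : Congruence (A.Sg {a, b}), SLWitness A a b θ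

def IsMajEdge (A : UAlgebra σ) (a b : A.carrier) : Prop :=
  a ≠ b ∧ ∃ θ : Congruence (A.Sg {a, b}), MajWitness A a b θ

def IsAffEdge (A : UAlgebra σ) (a b : A.carrier) : Prop :=
  a ≠ b ∧ ∃ θ : Congruence (A.Sg {a, b}), AffWitness A a b θ

end UAlgebra

/-- The four types of edges. -/
inductive EdgeType where
  | unary | semilattice | majority | affine
deriving DecidableEq

namespace UAlgebra

variable {σ : Signature}

def HasEdgeOfType (A : UAlgebra σ) (τ : EdgeType) (a b : A.carrier) : Prop :=
  match τ with
  | .unary => A.IsUnaryEdge a b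
  | .semilattice => A.IsSLEdge a b
  | .majority => A.IsMajEdge a b
  | .affine => A.IsAffEdge a b

/-- `T`-restricted algebra: every edge has a type from `T`. -/
def Restricted (A : UAlgebra σ) (T : Set EdgeType) : Prop :=
  ∀ a b : A.carrier, A.IsEdge a b → ∃ τ ∈ T, A.HasEdgeOfType τ a b

/-- `A` omits type 1: no subalgebra of `A` has an edge of the unary type. -/
def OmitsType1 (A : UAlgebra σ) : Prop :=
  ∀ (S : Set A.carrier) (hS : A.IsClosed S) (a b : (A.subalg S hS).carrier),
    ¬ (A.subalg S hS).IsUnaryEdge a b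

/-- The union of the two `θ`-blocks of a thick edge, as a subset of `A`. -/
def edgeBlockUnion (A : UAlgebra σ) (a b : A.carrier) (θ : Congruence (A.Sg {a, b})) :
    Set A.carrier :=
  {x | ∃ hx : x ∈ A.ClosureSet {a, b},
    θ.rel ⟨x, hx⟩ (A.sgA a b) ∨ θ.rel ⟨x, hx⟩ (A.sgB a b)}

/-- Smooth algebra: for every semilattice- or majority-type edge with a witnessing
maximal congruence, the union of the two blocks is a subuniverse. -/
def IsSmooth (A : UAlgebra σ) : Prop :=
  ∀ (a b : A.carrier) (θ : Congruence (A.Sg {a, b})),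
    (SLWitness A a b θ ∨ MajWitness A a b θ) → A.IsClosed (A.edgeBlockUnion a b θ)

def SemilatticeFree (A : UAlgebra σ) : Prop := ∀ a b : A.carrier, ¬ A.IsSLEdge a b
def MajorityFree (A : UAlgebra σ) : Prop := ∀ a b : A.carrier, ¬ A.IsMajEdge a b
def AffineFree (A : UAlgebra σ) : Prop := ∀ a b : A.carrier, ¬ A.IsAffEdge a b

/-- Thin semilattice edge. -/
def IsThinSLEdge (A : UAlgebra σ) (a b : A.carrier) : Prop :=
  ∃ t : Term σ 2, t.eval A ![a, a] = a ∧ t.eval A ![a, b] = b ∧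
    t.eval A ![b, a] = b ∧ t.eval A ![b, b] = b

/-- Undirected thin majority edge: some term operation is majority on `{a, b}`. -/
def IsUndirThinMajEdge (A : UAlgebra σ) (a b : A.carrier) : Prop :=
  ∃ t : Term σ 3, IsMajorityOn (fun x y z => t.eval A ![x, y, z]) {a, b}

/-- Mal'tsev edge: some term operation is Mal'tsev on `{a, b}`. -/
def IsMaltsevEdge (A : UAlgebra σ) (a b : A.carrier) : Prop :=
  ∃ t : Term σ 3, IsMaltsevOn (fun x y z => t.eval A ![x, y, z]) {a, b}

/-- The class of all quotients of subalgebras of `A`. -/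
def QuotSub (A : UAlgebra σ) : Set (UAlgebra σ) :=
  {B | ∃ (S : Set A.carrier) (hS : A.IsClosed S)
        (θ : Congruence (A.subalg S hS)), B = (A.subalg S hS).quot θ}

end UAlgebra

/-- The class of all quotients of subalgebras of the algebras of a class. -/
def QuotSubClass {σ : Signature} (K : Set (UAlgebra σ)) : Set (UAlgebra σ) :=
  {B | ∃ A ∈ K, B ∈ UAlgebra.QuotSub A}

/-- A ternary term satisfies the majority condition relative to a class `𝒦`. -/
def MajorityCondition {σ : Signature} (𝒦 : Set (UAlgebra σ)) (t : Term σ 3) : Prop :=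
  (∀ B ∈ 𝒦, ∀ x y : B.carrier,
    t.eval B ![x, t.eval B ![x, y, y], t.eval B ![x, y, y]] = t.eval B ![x, y, y]) ∧
  (∀ B ∈ 𝒦, ∀ (a b : B.carrier) (θ : UAlgebra.Congruence (B.Sg {a, b})),
    a ≠ b → UAlgebra.MajWitness B a b θ →
    IsMajorityOn (fun x y z => t.eval ((B.Sg {a, b}).quot θ) ![x, y, z])
      {B.qa a b θ, B.qb a b θ})

/-- A ternary term satisfies the minority condition relative to a class `𝒦`. -/
def MinorityCondition {σ : Signature} (𝒦 : Set (UAlgebra σ)) (t : Term σ 3) : Prop :=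
  (∀ B ∈ 𝒦, ∀ x y : B.carrier,
    t.eval B ![t.eval B ![x, y, y], y, y] = t.eval B ![x, y, y]) ∧
  (∀ B ∈ 𝒦, ∀ (a b : B.carrier) (θ : UAlgebra.Congruence (B.Sg {a, b})),
    a ≠ b → UAlgebra.AffWitness B a b θ →
    IsMaltsevOn (fun x y z => t.eval ((B.Sg {a, b}).quot θ) ![x, y, z])
      {B.qa a b θ, B.qb a b θ})

/-- Thin majority edge relative to a class `𝒦`. -/
def IsThinMajEdge {σ : Signature} (𝒦 : Set (UAlgebra σ)) (A : UAlgebra σ)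
    (a b : A.carrier) : Prop :=
  ∀ t : Term σ 3, MajorityCondition 𝒦 t →
    b ∈ A.ClosureSet {a, t.eval A ![a, b, b]} ∧
    b ∈ A.ClosureSet {a, t.eval A ![b, a, b]} ∧
    b ∈ A.ClosureSet {a, t.eval A ![b, b, a]}

/-- Thin affine edge relative to a class `𝒦` (with respect to some fixed term
operation satisfying the minority condition). -/
def IsThinAffEdge {σ : Signature} (𝒦 : Set (UAlgebra σ)) (A : UAlgebra σ)
    (a b : A.carrier) : Prop :=
  (∃ t : Term σ 3, MinorityCondition 𝒦 t ∧ t.eval A ![b, a, a] = b) ∧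
  ∀ t : Term σ 3, MinorityCondition 𝒦 t → b ∈ A.ClosureSet {a, t.eval A ![a, a, b]}

namespace UAlgebra

variable {σ : Signature}

/-- Reachability in the digraph `Gs(A)` of thin semilattice edges. -/
def sReach (A : UAlgebra σ) : A.carrier → A.carrier → Prop :=
  Relation.ReflTransGen (fun x y => A.IsThinSLEdge x y)

/-- A maximal element of `Gs(A)`: an element of a maximal strongly connected
component. -/
def IsMaxElem (A : UAlgebra σ) (a : A.carrier) : Prop :=
  ∀ b, A.sReach a b → A.sReach b a

/-- A maximal component of `Gs(A)`: the strongly connected component of a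
maximal element. -/
def IsMaxComponent (A : UAlgebra σ) (C : Set A.carrier) : Prop :=
  ∃ a, A.IsMaxElem a ∧ C = {b | A.sReach a b ∧ A.sReach b a}

end UAlgebra

/-- An arc of the digraph `Gas(A)`: a thin semilattice or thin affine edge. -/
def asStep {σ : Signature} (𝒦 : Set (UAlgebra σ)) (A : UAlgebra σ)
    (x y : A.carrier) : Prop :=
  A.IsThinSLEdge x y ∨ IsThinAffEdge 𝒦 A x y

/-- Reachability in `Gas(A)`. -/
def asReach {σ : Signature} (𝒦 : Set (UAlgebra σ)) (A : UAlgebra σ) :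
    A.carrier → A.carrier → Prop :=
  Relation.ReflTransGen (asStep 𝒦 A)

/-- An as-maximal element: an element of an as-component. -/
def IsAsMaxElem {σ : Signature} (𝒦 : Set (UAlgebra σ)) (A : UAlgebra σ)
    (a : A.carrier) : Prop :=
  ∀ b, asReach 𝒦 A a b → asReach 𝒦 A b a

/-- An as-component of `A`: a maximal strongly connected component of `Gas(A)`. -/
def IsAsComponent {σ : Signature} (𝒦 : Set (UAlgebra σ)) (A : UAlgebra σ)
    (C : Set A.carrier) : Prop :=
  ∃ a, IsAsMaxElem 𝒦 A a ∧ C = {b | asReach 𝒦 A a b ∧ asReach 𝒦 A b a}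

namespace UAlgebra

variable {σ : Signature}

/-- Binary direct product. -/
def prod (A B : UAlgebra σ) : UAlgebra σ where
  carrier := A.carrier × B.carrier
  interp f x := (A.interp f fun j => (x j).1, B.interp f fun j => (x j).2)

/-- Direct product of a family. -/
def pi {ι : Type} (A : ι → UAlgebra σ) : UAlgebra σ where
  carrier := ∀ i, (A i).carrier
  interp f x := fun i => (A i).interp f fun j => x j i

/-- Homomorphism of similar algebras. -/
def IsHom (A B : UAlgebra σ) (φ : A.carrier → B.carrier) : Prop :=
  ∀ (f : σ.ops) (x : Fin (σ.arity f) → A.carrier),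
    φ (A.interp f x) = B.interp f fun j => φ (x j)

/-- Simple algebra: only the equality and full congruences. -/
def IsSimple (A : UAlgebra σ) : Prop :=
  ∀ θ : Congruence A, (∀ x y, θ.rel x y ↔ x = y) ∨ θ.IsFull

/-- Maximal generated algebra: generated by one of its maximal components. -/
def MaximalGenerated (A : UAlgebra σ) : Prop :=
  ∃ C : Set A.carrier, A.IsMaxComponent C ∧ A.ClosureSet C = Set.univ

/-- The number of subalgebras (nonempty closed subsets) of an algebra. -/
noncomputable def numSubalgebras (A : UAlgebra σ) : ℕ :=
  Nat.card {S : Set A.carrier // S.Nonempty ∧ A.IsClosed S}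

end UAlgebra

/-- A (k+3)-ary term is an edge term for a class `𝒦`. -/
def IsEdgeTermFor {σ : Signature} (𝒦 : Set (UAlgebra σ)) {k : ℕ}
    (t : Term σ (k + 3)) : Prop :=
  ∀ A ∈ 𝒦, ∀ x y : A.carrier,
    t.eval A (fun i => if i.val ≤ 1 then y else x) = x ∧
    t.eval A (fun i => if i.val = 0 ∨ i.val = 2 then y else x) = x ∧
    ∀ j : Fin (k + 3), 3 ≤ j.val →
      t.eval A (Function.update (fun _ => x) j y) = x

/-- A finite class has few subproducts. -/
def FewSubproducts {σ : Signature} (K : Set (UAlgebra σ)) : Prop :=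
  ∃ p : Polynomial ℕ, ∀ (n : ℕ) (A : Fin n → UAlgebra σ), (∀ i, A i ∈ K) →
    UAlgebra.numSubalgebras (UAlgebra.pi A) ≤ 2 ^ (p.eval n)

/-- `g_K` is bounded by a polynomial: every subalgebra of an `n`-fold product
of members of `K` has a generating set of polynomial size. -/
def PolyGenerated {σ : Signature} (K : Set (UAlgebra σ)) : Prop :=
  ∃ p : Polynomial ℕ, ∀ (n : ℕ) (A : Fin n → UAlgebra σ), (∀ i, A i ∈ K) →
    ∀ S : Set (UAlgebra.pi A).carrier, S.Nonempty → (UAlgebra.pi A).IsClosed S →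
      ∃ G : Set (UAlgebra.pi A).carrier, G ⊆ S ∧ G.Finite ∧
        G.ncard ≤ p.eval n ∧ (UAlgebra.pi A).ClosureSet G = S

theorem exists_iterate_idempotent {α : Type*} [Finite α] (F : α → α) :
    ∃ N, 0 < N ∧ ∀ x, F^[N] (F^[N] x) = F^[N] x := by
  obtain ⟨i, j, hij, h⟩ := Finite.exists_ne_map_eq_of_infinite (fun n : ℕ => F^[n])
  wlog hlt : i < j generalizing i j
  · exact this j i hij.symm h.symm (by omega)
  obtain ⟨p, rfl⟩ := Nat.exists_eq_add_of_lt hlt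
  have per : ∀ k n, i ≤ n → F^[n + k * (p + 1)] = F^[n] := by
    intro k
    induction k with
    | zero => simp
    | succ k ih =>
      intro n hn
      obtain ⟨m, rfl⟩ := Nat.exists_eq_add_of_le hn
      have e : i + m + (k + 1) * (p + 1) = (m + (i + p + 1)) + k * (p + 1) := by ring
      rw [e, ih _ (by omega), Function.iterate_add, ← h, ← Function.iterate_add, Nat.add_comm]
  refine ⟨(i + 1) * (p + 1), by positivity, fun x => ?_⟩
  rw [← Function.iterate_add_apply, per _ _ (by nlinarith)]

namespace Term

variable {σ : Signature}

/-- Substitution of terms for the variables of a term. -/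
def subst {n m : ℕ} : Term σ n → (Fin n → Term σ m) → Term σ m
  | .var i, r => r i
  | .app f ts, r => .app f fun j => (ts j).subst r

theorem eval_subst {n m : ℕ} (A : UAlgebra σ) (t : Term σ n) (r : Fin n → Term σ m)
    (x : Fin m → A.carrier) :
    (t.subst r).eval A x = t.eval A fun i => (r i).eval A x := by
  induction t with
  | var i => rfl
  | app f ts ih => simp only [subst, eval, ih]

theorem eval_mem {n : ℕ} {A : UAlgebra σ} {D : Set A.carrier} (hD : A.IsClosed D)
    (t : Term σ n) {x : Fin n → A.carrier} (hx : ∀ i, x i ∈ D) : t.eval A x ∈ D := by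
  induction t with
  | var i => exact hx i
  | app f ts ih => exact hD f _ ih

theorem eval_const {n : ℕ} {A : UAlgebra σ} (hA : A.Idempotent) (t : Term σ n)
    (a : A.carrier) : (t.eval A fun _ => a) = a := by
  induction t with
  | var i => rfl
  | app f ts ih => simp only [eval, ih, hA f a]

end Term

namespace UAlgebra

variable {σ : Signature}

theorem IsHom.eval {A B : UAlgebra σ} {φ : A.carrier → B.carrier} (hφ : IsHom A B φ) {n : ℕ}
    (t : Term σ n) (x : Fin n → A.carrier) :
    φ (t.eval A x) = t.eval B fun i => φ (x i) := by
  induction t with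
  | var i => rfl
  | app f ts ih => simp only [Term.eval, hφ f, ih]

theorem isHom_fst (A B : UAlgebra σ) : IsHom (prod A B) A Prod.fst := fun _ _ => rfl

theorem isHom_snd (A B : UAlgebra σ) : IsHom (prod A B) B Prod.snd := fun _ _ => rfl

theorem isHom_proj {ι : Type} (A : ι → UAlgebra σ) (i : ι) :
    IsHom (pi A) (A i) fun x => x i := fun _ _ => rfl

/-- The binary operation defined by a term. -/
def bin (A : UAlgebra σ) (t : Term σ 2) (x y : A.carrier) : A.carrier := t.eval A ![x, y]

/-- The ternary operation defined by a term. -/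
def tri (A : UAlgebra σ) (t : Term σ 3) (x y z : A.carrier) : A.carrier := t.eval A ![x, y, z]

theorem comp_vec_two {α β : Type*} (φ : α → β) (x y : α) :
    (fun i => φ (![x, y] i)) = ![φ x, φ y] := by
  funext i; fin_cases i <;> rfl

theorem comp_vec_three {α β : Type*} (φ : α → β) (x y z : α) :
    (fun i => φ (![x, y, z] i)) = ![φ x, φ y, φ z] := by
  funext i; fin_cases i <;> rfl

theorem IsHom.bin {A B : UAlgebra σ} {φ : A.carrier → B.carrier} (hφ : IsHom A B φ)
    (t : Term σ 2) (x y : A.carrier) : φ (A.bin t x y) = B.bin t (φ x) (φ y) := by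
  rw [UAlgebra.bin, hφ.eval, comp_vec_two]; rfl

theorem IsHom.tri {A B : UAlgebra σ} {φ : A.carrier → B.carrier} (hφ : IsHom A B φ)
    (t : Term σ 3) (x y z : A.carrier) : φ (A.tri t x y z) = B.tri t (φ x) (φ y) (φ z) := by
  rw [UAlgebra.tri, hφ.eval, comp_vec_three]; rfl

theorem bin_prod (A B : UAlgebra σ) (t : Term σ 2) (p q : (prod A B).carrier) :
    (prod A B).bin t p q = (A.bin t p.1 q.1, B.bin t p.2 q.2) :=
  Prod.ext ((isHom_fst A B).bin t p q) ((isHom_snd A B).bin t p q)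

theorem tri_prod (A B : UAlgebra σ) (t : Term σ 3) (p q r : (prod A B).carrier) :
    (prod A B).tri t p q r = (A.tri t p.1 q.1 r.1, B.tri t p.2 q.2 r.2) :=
  Prod.ext ((isHom_fst A B).tri t p q r) ((isHom_snd A B).tri t p q r)

theorem bin_prod_mk (A B : UAlgebra σ) (t : Term σ 2) (a a' : A.carrier) (b b' : B.carrier) :
    (prod A B).bin t (a, b) (a', b') = (A.bin t a a', B.bin t b b') :=
  bin_prod A B t (a, b) (a', b')

theorem tri_prod_mk (A B : UAlgebra σ) (t : Term σ 3) (a a' a'' : A.carrier)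
    (b b' b'' : B.carrier) :
    (prod A B).tri t (a, b) (a', b') (a'', b'') = (A.tri t a a' a'', B.tri t b b' b'') :=
  tri_prod A B t (a, b) (a', b') (a'', b'')

theorem bin_prod_prod_mk (A B D : UAlgebra σ) (t : Term σ 2) (a a' : A.carrier)
    (b b' : B.carrier) (d d' : D.carrier) :
    (prod A (prod B D)).bin t (a, b, d) (a', b', d') =
      (A.bin t a a', B.bin t b b', D.bin t d d') :=
  (bin_prod_mk A (prod B D) t a a' (b, d) (b', d')).trans
    (congrArg (Prod.mk _) (bin_prod_mk B D t b b' d d'))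

theorem tri_prod_prod_mk (A B D : UAlgebra σ) (t : Term σ 3) (a a' a'' : A.carrier)
    (b b' b'' : B.carrier) (d d' d'' : D.carrier) :
    (prod A (prod B D)).tri t (a, b, d) (a', b', d') (a'', b'', d'') =
      (A.tri t a a' a'', B.tri t b b' b'', D.tri t d d' d'') :=
  (tri_prod_mk A (prod B D) t a a' a'' (b, d) (b', d') (b'', d'')).trans
    (congrArg (Prod.mk _) (tri_prod_mk B D t b b' b'' d d' d''))

theorem eval_prod (A B : UAlgebra σ) {n : ℕ} (t : Term σ n) (x : Fin n → (prod A B).carrier) :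
    t.eval (prod A B) x = (t.eval A fun i => (x i).1, t.eval B fun i => (x i).2) :=
  Prod.ext ((isHom_fst A B).eval t x) ((isHom_snd A B).eval t x)

theorem IsClosed.bin_mem {A : UAlgebra σ} {D : Set A.carrier} (hD : A.IsClosed D)
    (t : Term σ 2) {x y : A.carrier} (hx : x ∈ D) (hy : y ∈ D) : A.bin t x y ∈ D :=
  t.eval_mem hD fun i => by fin_cases i <;> assumption

theorem IsClosed.tri_mem {A : UAlgebra σ} {D : Set A.carrier} (hD : A.IsClosed D)
    (t : Term σ 3) {x y z : A.carrier} (hx : x ∈ D) (hy : y ∈ D) (hz : z ∈ D) :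
    A.tri t x y z ∈ D :=
  t.eval_mem hD fun i => by fin_cases i <;> assumption

theorem Idempotent.bin_self {A : UAlgebra σ} (hA : A.Idempotent) (t : Term σ 2)
    (x : A.carrier) : A.bin t x x = x := by
  rw [bin, show ![x, x] = fun _ => x from by funext i; fin_cases i <;> rfl]
  exact t.eval_const hA x

theorem Idempotent.tri_self {A : UAlgebra σ} (hA : A.Idempotent) (t : Term σ 3)
    (x : A.carrier) : A.tri t x x x = x := by
  rw [tri, show ![x, x, x] = fun _ => x from by funext i; fin_cases i <;> rfl]
  exact t.eval_const hA x

theorem Idempotent.pi {ι : Type} {A : ι → UAlgebra σ} (hA : ∀ i, (A i).Idempotent) :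
    (pi A).Idempotent := fun f a => funext fun i => hA i f (a i)

theorem Idempotent.isClosed_singleton {A : UAlgebra σ} (hA : A.Idempotent) (a : A.carrier) :
    A.IsClosed {a} := by
  intro f x hx
  obtain rfl : x = fun _ => a := funext hx
  exact hA f a

theorem closureSet_subset {A : UAlgebra σ} {G D : Set A.carrier} (hD : A.IsClosed D)
    (h : G ⊆ D) : A.ClosureSet G ⊆ D := by
  intro x hx
  induction hx with
  | base ha => exact h ha
  | app f x _ ih => exact hD f x ih

theorem subset_closureSet (A : UAlgebra σ) (G : Set A.carrier) : G ⊆ A.ClosureSet G :=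
  fun _ h => Closure.base h

theorem closureSet_mono (A : UAlgebra σ) {G H : Set A.carrier} (h : G ⊆ H) :
    A.ClosureSet G ⊆ A.ClosureSet H :=
  closureSet_subset (A.closureSet_isClosed H) (h.trans (A.subset_closureSet H))

theorem isClosed_univ (A : UAlgebra σ) : A.IsClosed Set.univ := fun _ _ _ => trivial

theorem IsClosed.inter {A : UAlgebra σ} {D E : Set A.carrier} (hD : A.IsClosed D)
    (hE : A.IsClosed E) : A.IsClosed (D ∩ E) :=
  fun f x h => ⟨hD f x fun j => (h j).1, hE f x fun j => (h j).2⟩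

theorem IsHom.isClosed_preimage {A B : UAlgebra σ} {φ : A.carrier → B.carrier}
    (hφ : IsHom A B φ) {D : Set B.carrier} (hD : B.IsClosed D) : A.IsClosed (φ ⁻¹' D) := by
  intro f x h
  rw [Set.mem_preimage, hφ f]
  exact hD f _ h

theorem IsHom.isClosed_image {A B : UAlgebra σ} {φ : A.carrier → B.carrier}
    (hφ : IsHom A B φ) {D : Set A.carrier} (hD : A.IsClosed D) : B.IsClosed (φ '' D) := by
  intro f x h
  choose y hy hyx using h
  refine ⟨A.interp f y, hD f y hy, ?_⟩
  rw [hφ f]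
  simp only [hyx]

theorem mem_closureSet_range {A : UAlgebra σ} {n : ℕ} {g : Fin n → A.carrier} {a : A.carrier} :
    a ∈ A.ClosureSet (Set.range g) ↔ ∃ t : Term σ n, t.eval A g = a := by
  constructor
  · intro h
    induction h with
    | base ha => obtain ⟨i, rfl⟩ := ha; exact ⟨.var i, rfl⟩
    | app f x _ ih =>
      choose t ht using ih
      exact ⟨.app f t, by simp only [Term.eval, ht]⟩
  · rintro ⟨t, rfl⟩
    exact t.eval_mem (A.closureSet_isClosed _) fun i => Closure.base ⟨i, rfl⟩

theorem mem_closureSet_pair {A : UAlgebra σ} {x y a : A.carrier} :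
    a ∈ A.ClosureSet {x, y} ↔ ∃ t : Term σ 2, A.bin t x y = a := by
  rw [show ({x, y} : Set A.carrier) = Set.range ![x, y] by simp [Set.pair_comm]]
  exact mem_closureSet_range

theorem mem_closureSet_triple {A : UAlgebra σ} {x y z a : A.carrier} :
    a ∈ A.ClosureSet {x, y, z} ↔ ∃ t : Term σ 3, A.tri t x y z = a := by
  rw [show ({x, y, z} : Set A.carrier) = Set.range ![x, y, z] by
    ext w; simp [eq_comm]; tauto]
  exact mem_closureSet_range

theorem IsHom.image_closureSet_pair {A B : UAlgebra σ} {φ : A.carrier → B.carrier}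
    (hφ : IsHom A B φ) (x y : A.carrier) :
    φ '' A.ClosureSet {x, y} = B.ClosureSet {φ x, φ y} := by
  ext z
  simp only [Set.mem_image, mem_closureSet_pair]
  constructor
  · rintro ⟨_, ⟨t, rfl⟩, rfl⟩
    exact ⟨t, (hφ.bin t x y).symm⟩
  · rintro ⟨t, rfl⟩
    exact ⟨_, ⟨t, rfl⟩, hφ.bin t x y⟩

theorem left_mem_closureSet_pair {A : UAlgebra σ} (x y : A.carrier) :
    x ∈ A.ClosureSet {x, y} := Closure.base (Set.mem_insert x {y})

theorem right_mem_closureSet_pair {A : UAlgebra σ} (x y : A.carrier) :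
    y ∈ A.ClosureSet {x, y} := Closure.base (Set.mem_insert_of_mem x rfl)

theorem closureSet_pair_subset {A : UAlgebra σ} {x y : A.carrier} {D : Set A.carrier}
    (hD : A.IsClosed D) (hx : x ∈ D) (hy : y ∈ D) : A.ClosureSet {x, y} ⊆ D :=
  closureSet_subset hD (Set.insert_subset hx (Set.singleton_subset_iff.mpr hy))

/-! ### Partial semilattice terms -/

/-- `s` is a partial semilattice term of `A`. -/
def IsPartialSL (A : UAlgebra σ) (s : Term σ 2) : Prop :=
  ∀ x y, A.bin s x (A.bin s x y) = A.bin s x y ∧ A.bin s (A.bin s x y) x = A.bin s x y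

/-- Iteration of a binary term in its second variable. -/
def _root_.Term.iterRight (f : Term σ 2) : ℕ → Term σ 2
  | 0 => .var 1
  | n + 1 => f.subst ![.var 0, Term.iterRight f n]

theorem bin_subst (A : UAlgebra σ) (f p q : Term σ 2) (x y : A.carrier) :
    A.bin (f.subst ![p, q]) x y = A.bin f (A.bin p x y) (A.bin q x y) := by
  rw [bin, Term.eval_subst, comp_vec_two fun t : Term σ 2 => t.eval A ![x, y]]; rfl

theorem bin_iterRight (A : UAlgebra σ) (f : Term σ 2) (n : ℕ) (x y : A.carrier) :
    A.bin (f.iterRight n) x y = (A.bin f x)^[n] y := by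
  induction n with
  | zero => rfl
  | succ n ih => rw [Term.iterRight, bin_subst, ih, Function.iterate_succ_apply']; rfl

theorem exists_iterRight_idempotent (A : UAlgebra σ) [Finite A.carrier] (f : Term σ 2) :
    ∃ n, ∀ x y, A.bin (f.iterRight (n + 1)) x (A.bin (f.iterRight (n + 1)) x y) =
      A.bin (f.iterRight (n + 1)) x y := by
  obtain ⟨N, hN, h⟩ := exists_iterate_idempotent
    (fun p : A.carrier × A.carrier => (p.1, A.bin f p.1 p.2))
  obtain ⟨n, rfl⟩ := Nat.exists_eq_add_of_lt hN
  have key : ∀ (k : ℕ) (x y : A.carrier),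
      (fun p : A.carrier × A.carrier => (p.1, A.bin f p.1 p.2))^[k] (x, y) =
        (x, (A.bin f x)^[k] y) := by
    intro k x y
    induction k with
    | zero => rfl
    | succ k ih => rw [Function.iterate_succ_apply', ih, Function.iterate_succ_apply']
  refine ⟨n, fun x y => ?_⟩
  have := h (x, y)
  rw [key, key] at this
  simp only [bin_iterRight]
  simpa using congrArg Prod.snd this

theorem iterRight_mem {B : UAlgebra σ} {D : Set B.carrier} {f : Term σ 2} {x y : B.carrier}
    (hy : y ∈ D) (h : ∀ d ∈ D, B.bin f x d ∈ D) (n : ℕ) : B.bin (f.iterRight n) x y ∈ D := by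
  rw [bin_iterRight]
  induction n with
  | zero => exact hy
  | succ n ih => rw [Function.iterate_succ_apply']; exact h _ ih

theorem iterRight_succ_mem {B : UAlgebra σ} {D : Set B.carrier} {f : Term σ 2} {x y : B.carrier}
    (hy : B.bin f x y ∈ D) (h : ∀ d ∈ D, B.bin f x d ∈ D) (n : ℕ) :
    B.bin (f.iterRight (n + 1)) x y ∈ D := by
  have := iterRight_mem hy h n
  rwa [bin_iterRight] at this ⊢

theorem exists_isPartialSL {A : UAlgebra σ} [Finite A.carrier] (hA : A.Idempotent)
    (f : Term σ 2) :
    ∃ s, A.IsPartialSL s ∧ ∀ (B : UAlgebra σ) (D : Set B.carrier) (x y : B.carrier), y ∈ D →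
      (∀ d ∈ D, B.bin f x d ∈ D) → (∀ d ∈ D, B.bin f d x ∈ D) →
      (∀ d ∈ D, ∀ d' ∈ D, B.bin f d d' ∈ D) → B.bin s x y ∈ D := by
  obtain ⟨n, hn⟩ := exists_iterRight_idempotent A f
  set g := f.iterRight (n + 1) with hg
  set h : Term σ 2 := g.subst ![.var 0, g.subst ![.var 1, .var 0]] with hh
  have bin_h : ∀ (B : UAlgebra σ) (x y : B.carrier),
      B.bin h x y = B.bin g x (B.bin g y x) := by
    intro B x y
    rw [hh, bin_subst, bin_subst]; rfl
  obtain ⟨m, hm⟩ := exists_iterRight_idempotent A h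
  refine ⟨h.iterRight (m + 1), fun x y => ⟨hm x y, ?_⟩, ?_⟩
  · set v := A.bin (h.iterRight (m + 1)) x y with hv
    have hgv : A.bin g x v = v := by
      rw [hv, bin_iterRight A h, Function.iterate_succ_apply', bin_h, hn]
    have h2 : ∀ w, w = x ∨ w = v → A.bin h v w = v := by
      rintro w (rfl | rfl)
      · rw [bin_h, hgv, hA.bin_self]
      · rw [bin_h, hA.bin_self, hA.bin_self]
    exact iterRight_succ_mem (D := {v}) (h2 x (.inl rfl)) (by rintro d rfl; exact h2 _ (.inr rfl)) m
  · intro B D x y hy h1 h2 h3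
    refine iterRight_mem hy (fun d hd => ?_) _
    rw [bin_h]
    exact iterRight_mem (iterRight_succ_mem (h2 d hd) (h3 d hd) n) h1 _

theorem IsPartialSL.isThinSLEdge {A : UAlgebra σ} (hA : A.Idempotent) {s : Term σ 2}
    (hs : A.IsPartialSL s) (x y : A.carrier) : A.IsThinSLEdge x (A.bin s x y) :=
  ⟨s, hA.bin_self s x, (hs x y).1, (hs x y).2, hA.bin_self s _⟩

/-! ### Reachability by prescribed binary terms -/

/-- One step `u ↦ s(u, z)` with `s` an admissible binary term and `z ∈ D`. -/
def Move (Ψ : Term σ 2 → Prop) (B : UAlgebra σ) (D : Set B.carrier) (u v : B.carrier) : Prop :=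
  ∃ s, Ψ s ∧ ∃ z ∈ D, v = B.bin s u z

/-- Reachability by admissible steps inside `D`. -/
def Reach (Ψ : Term σ 2 → Prop) (B : UAlgebra σ) (D : Set B.carrier) :
    B.carrier → B.carrier → Prop :=
  Relation.ReflTransGen (Move Ψ B D)

section Reach

variable {Ψ : Term σ 2 → Prop} {B V : UAlgebra σ}

theorem Reach.mono {D E : Set B.carrier} (h : D ⊆ E) {u v : B.carrier}
    (huv : Reach Ψ B D u v) : Reach Ψ B E u v :=
  Relation.ReflTransGen.mono (fun _ _ ⟨s, hs, z, hz, e⟩ => ⟨s, hs, z, h hz, e⟩) _ _ huv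

theorem Reach.mem_of_forall {D E : Set B.carrier}
    (hE : ∀ u ∈ E, ∀ s, Ψ s → ∀ z ∈ D, B.bin s u z ∈ E) {u v : B.carrier} (hu : u ∈ E)
    (huv : Reach Ψ B D u v) : v ∈ E := by
  induction huv with
  | refl => exact hu
  | tail _ h ih => obtain ⟨s, hs, z, hz, rfl⟩ := h; exact hE _ ih s hs z hz

theorem Reach.mem {D E : Set B.carrier} (hE : B.IsClosed E) (hDE : D ⊆ E) {u v : B.carrier}
    (hu : u ∈ E) (huv : Reach Ψ B D u v) : v ∈ E :=
  huv.mem_of_forall (fun _ hu s _ _ hz => hE.bin_mem s hu (hDE hz)) hu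

theorem Reach.map {p : B.carrier → V.carrier} (hp : IsHom B V p) {D : Set B.carrier}
    {u v : B.carrier} (huv : Reach Ψ B D u v) : Reach Ψ V (p '' D) (p u) (p v) := by
  induction huv with
  | refl => exact .refl
  | tail _ h ih =>
    obtain ⟨s, hs, z, hz, rfl⟩ := h
    exact ih.tail ⟨s, hs, p z, ⟨z, hz, rfl⟩, hp.bin s _ z⟩

theorem Reach.lift {p : B.carrier → V.carrier} (hp : IsHom B V p) {D : Set B.carrier}
    {u : B.carrier} {v' : V.carrier} (h : Reach Ψ V (p '' D) (p u) v') :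
    ∃ v, Reach Ψ B D u v ∧ p v = v' := by
  induction h with
  | refl => exact ⟨u, .refl, rfl⟩
  | tail _ h ih =>
    obtain ⟨s, hs, _, ⟨z, hz, rfl⟩, rfl⟩ := h
    obtain ⟨v, hv, rfl⟩ := ih
    exact ⟨_, hv.tail ⟨s, hs, z, hz, rfl⟩, hp.bin s v z⟩

end Reach

theorem isHom_swap (A : UAlgebra σ) : IsHom (prod A A) (prod A A) Prod.swap := fun _ _ => rfl

theorem mem_closureSet_swap {A : UAlgebra σ} {G : Set (A.carrier × A.carrier)}
    (hG : ∀ u v, (u, v) ∈ G → (v, u) ∈ G) {u v : A.carrier}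
    (h : (u, v) ∈ (prod A A).ClosureSet G) : (v, u) ∈ (prod A A).ClosureSet G :=
  have hcl := (isHom_swap A).isClosed_preimage ((prod A A).closureSet_isClosed G)
  closureSet_subset hcl (fun p hp => Closure.base (hG p.1 p.2 hp)) h

theorem IsClosed.relFiber {A B : UAlgebra σ} {D : Set (prod A B).carrier}
    (hD : (prod A B).IsClosed D) (hA : A.Idempotent) (a : A.carrier) :
    B.IsClosed {w | (a, w) ∈ D} := by
  intro f x h
  have := hD f (fun j => (a, x j)) h
  have e : (prod A B).interp f (fun j => (a, x j)) = (a, B.interp f x) :=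
    Prod.ext (hA f a) rfl
  rwa [e] at this

theorem IsClosed.relImage {A B : UAlgebra σ} {D : Set (prod A B).carrier}
    (hD : (prod A B).IsClosed D) {C : Set B.carrier} (hC : B.IsClosed C) :
    A.IsClosed {u | ∃ w ∈ C, (u, w) ∈ D} := by
  intro f x h
  choose w hw hx using h
  exact ⟨B.interp f w, hC f w hw, hD f (fun j => (x j, w j)) hx⟩

theorem IsClosed.bin_pair_mem {A B : UAlgebra σ} {D : Set (prod A B).carrier}
    (hD : (prod A B).IsClosed D) (t : Term σ 2) {a a' : A.carrier} {b b' : B.carrier}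
    (h : (a, b) ∈ D) (h' : (a', b') ∈ D) : (A.bin t a a', B.bin t b b') ∈ D := by
  have := hD.bin_mem t h h'
  rwa [bin_prod_mk] at this

theorem IsClosed.eval_pair_mem {A B : UAlgebra σ} {D : Set (prod A B).carrier}
    (hD : (prod A B).IsClosed D) {n : ℕ} (t : Term σ n) {a : Fin n → A.carrier}
    {b : Fin n → B.carrier} (h : ∀ i, (a i, b i) ∈ D) : (t.eval A a, t.eval B b) ∈ D := by
  exact eval_prod A B t (fun i => (a i, b i)) ▸ t.eval_mem hD h

/-- The transitive closure of a compatible reflexive symmetric relation, as a congruence. -/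
def transCongruence (A : UAlgebra σ) (R : A.carrier → A.carrier → Prop) (hr : ∀ x, R x x)
    (hs : ∀ x y, R x y → R y x)
    (hc : ∀ (f : σ.ops) (x y : Fin (σ.arity f) → A.carrier),
      (∀ j, R (x j) (y j)) → R (A.interp f x) (A.interp f y)) : Congruence A where
  rel := Relation.ReflTransGen R
  refl _ := .refl
  symm h := by
    induction h with
    | refl => exact .refl
    | tail _ h ih => exact ih.head (hs _ _ h)
  trans := Relation.ReflTransGen.trans
  compat f x y hxy := by
    have one : ∀ (z : Fin (σ.arity f) → A.carrier) (j : Fin (σ.arity f)) (u v : A.carrier),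
        Relation.ReflTransGen R u v → Relation.ReflTransGen R
          (A.interp f (Function.update z j u)) (A.interp f (Function.update z j v)) := by
      intro z j u v h
      induction h with
      | refl => exact .refl
      | @tail v w _ h ih =>
        refine ih.tail (hc f _ _ fun k => ?_)
        by_cases hk : k = j
        · subst hk; simpa using h
        · simpa [hk] using hr _
    have all : ∀ I : Finset (Fin (σ.arity f)),
        Relation.ReflTransGen R (A.interp f x) (A.interp f (I.piecewise y x)) := by
      intro I
      induction I using Finset.induction_on with
      | empty => simpa using Relation.ReflTransGen.refl
      | insert j I hj ih =>
        refine ih.trans ?_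
        have := one (I.piecewise y x) j (x j) (y j) (hxy j)
        rw [Finset.piecewise_insert]
        convert this using 2
        symm
        rw [Function.update_eq_self_iff, Finset.piecewise_eq_of_notMem _ _ _ hj]
    simpa using all Finset.univ

/-- The elements of `E` from which `C` cannot be reached inside `E`. -/
def Away (Ψ : Term σ 2 → Prop) (B : UAlgebra σ) (E C : Set B.carrier) : Set B.carrier :=
  {x | x ∈ E ∧ ∀ c ∈ C, ¬ Reach Ψ B E x c}

theorem away_reach {Ψ : Term σ 2 → Prop} {B : UAlgebra σ} {E C : Set B.carrier}
    (hE : B.IsClosed E) {x y : B.carrier} (hx : x ∈ Away Ψ B E C) (h : Reach Ψ B E x y) :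
    y ∈ Away Ψ B E C :=
  ⟨h.mem hE subset_rfl hx.1, fun c hc hy => hx.2 c hc (h.trans hy)⟩

theorem exists_reach_of_notMem_away {Ψ : Term σ 2 → Prop} {B : UAlgebra σ} {E C : Set B.carrier}
    {x : B.carrier} (hx : x ∈ E) (h : x ∉ Away Ψ B E C) : ∃ c ∈ C, Reach Ψ B E x c := by
  by_contra! h'
  exact h ⟨hx, h'⟩

/-- The subalgebra of `S × S` generated by the pairs meeting `C`. -/
abbrev crossRel (S : UAlgebra σ) (C : Set S.carrier) : Set (S.carrier × S.carrier) :=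
  (prod S S).ClosureSet {p : S.carrier × S.carrier | p.1 ∈ C ∨ p.2 ∈ C}

/-- The subalgebra of `S × S` generated by `(x, c)` and `(c, x)`. -/
abbrev swapRel (S : UAlgebra σ) (x c : S.carrier) : Set (S.carrier × S.carrier) :=
  (prod S S).ClosureSet {(x, c), (c, x)}

/-- The elements related by `crossRel` to an element from which `C` cannot be reached. -/
abbrev hat (Ψ : Term σ 2 → Prop) (S : UAlgebra σ) (C : Set S.carrier) : Set S.carrier :=
  {y | ∃ x ∈ Away Ψ S Set.univ C, (y, x) ∈ crossRel S C}

/-- The subalgebra of `S × S × S` generated by `(x, c, c)`, `(c, x, c)` and `(c, c, x)`. -/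
abbrev cyclicRel (S : UAlgebra σ) (x c : S.carrier) :
    Set (S.carrier × S.carrier × S.carrier) :=
  (prod S (prod S S)).ClosureSet {(x, c, c), (c, x, c), (c, c, x)}

/-- An idempotent algebra with a closed upward closed set `C` that is minimal among those
containing both an element of `C` and an element from which `C` cannot be reached. -/
structure Preconfig (Ψ : Term σ 2 → Prop) (S : UAlgebra σ) (C : Set S.carrier)
    (x0 c0 : S.carrier) : Prop where
  idem : S.Idempotent
  closed : S.IsClosed C
  up : ∀ c ∈ C, ∀ s, Ψ s → ∀ z, S.bin s c z ∈ C
  memX : x0 ∈ Away Ψ S Set.univ C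
  memC : c0 ∈ C
  gen : ∀ x ∈ Away Ψ S Set.univ C, ∀ c ∈ C, S.ClosureSet {x, c} = Set.univ
  sep : ∀ u v, (u, v) ∈ crossRel S C →
    u ∈ Away Ψ S Set.univ C → v ∉ Away Ψ S Set.univ C
  drain : ∀ D, S.IsClosed D → D ≠ Set.univ → (D ∩ C).Nonempty → ∀ u ∈ D,
    ∃ c ∈ C, Reach Ψ S D u c

/-- A simple preconfiguration with enough admissible terms; the pair `x0`, `c0` must then be
either of unary or of majority kind. -/
structure Config (Ψ : Term σ 2 → Prop) (S : UAlgebra σ) (C : Set S.carrier)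
    (x0 c0 : S.carrier) : Prop extends Preconfig Ψ S C x0 c0 where
  simple : S.IsSimple
  absorb : ∀ (f : Term σ 2) (x c : S.carrier), S.bin f x c = c → S.bin f c x = c →
    ∃ s, Ψ s ∧ S.bin s x c = c

namespace Config

variable {Ψ : Term σ 2 → Prop} {S : UAlgebra σ} {C : Set S.carrier} {x0 c0 : S.carrier}

local notation "X" => Away Ψ S Set.univ C
local notation "T" => crossRel S C
local notation "T₀" => swapRel S x0 c0
local notation "Ĉ" => hat Ψ S C

theorem up_reach (h : Config Ψ S C x0 c0) {c d : S.carrier} (hc : c ∈ C)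
    (hr : Reach Ψ S Set.univ c d) : d ∈ C :=
  hr.mem_of_forall (fun u hu s hs z _ => h.up u hu s hs z) hc

theorem notMem_away {c : S.carrier} (hc : c ∈ C) : c ∉ X := fun hx => hx.2 c hc .refl

theorem eq_univ (h : Config Ψ S C x0 c0) {D : Set S.carrier} (hD : S.IsClosed D)
    {x c : S.carrier} (hx : x ∈ X) (hc : c ∈ C) (hxD : x ∈ D) (hcD : c ∈ D) (y : S.carrier) :
    y ∈ D :=
  closureSet_pair_subset hD hxD hcD (by rw [h.gen x hx c hc]; trivial)

theorem T_swap {u v : S.carrier} (hp : (u, v) ∈ T) : (v, u) ∈ T :=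
  mem_closureSet_swap (fun _ _ => Or.symm) hp

theorem T₀_swap {u v : S.carrier} (hp : (u, v) ∈ T₀) : (v, u) ∈ T₀ := by
  refine mem_closureSet_swap (fun u v => ?_) hp
  rintro (e | e) <;> obtain ⟨rfl, rfl⟩ := Prod.mk.inj e
  exacts [Or.inr rfl, Or.inl rfl]

theorem mem_T_left {c : S.carrier} (hc : c ∈ C) (s : S.carrier) : (c, s) ∈ T :=
  Closure.base (Or.inl hc)

theorem mem_T_right {c : S.carrier} (hc : c ∈ C) (s : S.carrier) : (s, c) ∈ T :=
  Closure.base (Or.inr hc)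

theorem xc_mem : ((x0, c0) : (prod S S).carrier) ∈ T₀ := left_mem_closureSet_pair _ _

theorem cx_mem : ((c0, x0) : (prod S S).carrier) ∈ T₀ := right_mem_closureSet_pair _ _

theorem T₀_subset (h : Config Ψ S C x0 c0) : T₀ ⊆ T :=
  closureSet_pair_subset ((prod S S).closureSet_isClosed _) (mem_T_right h.memC _)
    (mem_T_left h.memC _)

theorem T₀_total (h : Config Ψ S C x0 c0) (u : S.carrier) : ∃ v, (u, v) ∈ T₀ := by
  have hcl := ((prod S S).closureSet_isClosed {(x0, c0), (c0, x0)}).relImage S.isClosed_univ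
  obtain ⟨v, -, hv⟩ := h.eq_univ hcl h.memX h.memC ⟨c0, trivial, xc_mem⟩ ⟨x0, trivial, cx_mem⟩ u
  exact ⟨v, hv⟩

theorem T₀_lift (h : Config Ψ S C x0 c0) {u v u' : S.carrier} (huv : (u, v) ∈ T₀)
    (hu : Reach Ψ S Set.univ u u') : ∃ v', (u', v') ∈ T₀ ∧ Reach Ψ S Set.univ v v' := by
  have himg : Prod.fst '' T₀ = Set.univ := by
    ext w
    obtain ⟨v, hv⟩ := h.T₀_total w
    simp only [Set.mem_univ, iff_true]
    exact ⟨(w, v), hv, rfl⟩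
  rw [← himg] at hu
  obtain ⟨⟨a, v'⟩, hq, rfl⟩ := Reach.lift (u := (u, v)) (isHom_fst S S) hu
  exact ⟨v', hq.mem ((prod S S).closureSet_isClosed _) subset_rfl huv,
    (hq.map (isHom_snd S S)).mono (Set.subset_univ _)⟩

theorem no_absorb (h : Config Ψ S C x0 c0) (f : Term σ 2) (h1 : S.bin f x0 c0 = c0)
    (h2 : S.bin f c0 x0 = c0) : False := by
  obtain ⟨s, hs, e⟩ := h.absorb f x0 c0 h1 h2
  exact h.memX.2 c0 h.memC (.single ⟨s, hs, c0, trivial, e.symm⟩)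

theorem no_semilattice (h : Config Ψ S C x0 c0) (f : Term σ 2) :
    ¬ IsSemilatticeOn (S.bin f) {x0, c0} := by
  rintro ⟨-, hcomm, hassoc⟩
  have hx : x0 ∈ ({x0, c0} : Set S.carrier) := by simp
  have hc : c0 ∈ ({x0, c0} : Set S.carrier) := by simp
  have e := hcomm x0 hx c0 hc
  have e1 : S.bin f x0 (S.bin f x0 c0) = S.bin f x0 c0 := by
    rw [hassoc x0 hx x0 hx c0 hc, h.idem.bin_self]
  have e2 : S.bin f (S.bin f x0 c0) x0 = S.bin f x0 c0 := by
    rw [e, ← hassoc c0 hc x0 hx x0 hx, h.idem.bin_self]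
  obtain ⟨s, hs, e3⟩ := h.absorb f x0 _ e1 e2
  have hw : S.bin f x0 c0 ∈ X :=
    away_reach S.isClosed_univ h.memX (.single ⟨s, hs, _, trivial, e3.symm⟩)
  have hT := ((prod S S).closureSet_isClosed _).bin_pair_mem f
    (mem_T_right h.memC x0) (mem_T_left h.memC x0)
  rw [← e] at hT
  exact h.sep _ _ hT hw hw

theorem T₀_not_both (h : Config Ψ S C x0 c0) {c d : S.carrier} (hc : c ∈ C) (hd : d ∈ C) :
    (c, d) ∉ T₀ := by
  intro hcd
  have hcl := (prod S S).closureSet_isClosed {(x0, c0), (c0, x0)}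
  obtain ⟨w, hw, hcw⟩ :=
    h.eq_univ (hcl.relImage h.closed) h.memX hc ⟨c0, h.memC, xc_mem⟩ ⟨d, hd, hcd⟩ c0
  have hcc := h.eq_univ (hcl.relFiber h.idem c0) h.memX hw cx_mem hcw c0
  obtain ⟨f, hf⟩ := mem_closureSet_pair.mp hcc
  rw [bin_prod_mk] at hf
  exact h.no_absorb f (congrArg Prod.fst hf) (congrArg Prod.snd hf)

theorem away_of_link (h : Config Ψ S C x0 c0) {u u' v : S.carrier} (huv : (u, v) ∈ T₀)
    (huv' : (u', v) ∈ T₀) (hu : u ∈ X) : u' ∈ X := by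
  by_contra hu'
  obtain ⟨c1, hc1, hr⟩ := exists_reach_of_notMem_away (Set.mem_univ _) hu'
  obtain ⟨v1, hv1, hr1⟩ := h.T₀_lift huv' hr
  by_cases hX : v1 ∈ X
  · obtain ⟨u1, hu1, hr2⟩ := h.T₀_lift (T₀_swap huv) hr1
    exact h.sep _ _ (h.T₀_subset hu1) hX (away_reach S.isClosed_univ hu hr2)
  · obtain ⟨c2, hc2, hr2⟩ := exists_reach_of_notMem_away (Set.mem_univ _) hX
    obtain ⟨w, hw, hr3⟩ := h.T₀_lift (T₀_swap hv1) hr2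
    exact h.T₀_not_both hc2 (h.up_reach hc1 hr3) hw

theorem T₀_inj (h : Config Ψ S C x0 c0) {u u' v : S.carrier} (huv : (u, v) ∈ T₀)
    (huv' : (u', v) ∈ T₀) : u = u' := by
  let θ := S.transCongruence (fun u u' => ∃ v, (u, v) ∈ T₀ ∧ (u', v) ∈ T₀)
    (fun u => (h.T₀_total u).imp fun _ hv => ⟨hv, hv⟩)
    (fun _ _ hv => hv.imp fun _ hv => ⟨hv.2, hv.1⟩)
    (fun f x y hxy => by
      choose w hx hy using hxy
      have hcl := (prod S S).closureSet_isClosed {(x0, c0), (c0, x0)}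
      exact ⟨S.interp f w, hcl f (fun j => (x j, w j)) hx, hcl f (fun j => (y j, w j)) hy⟩)
  have hX : ∀ a b, θ.rel a b → a ∈ X → b ∈ X := by
    intro a b hab ha
    induction hab with
    | refl => exact ha
    | tail _ h' ih => obtain ⟨v, h1, h2⟩ := h'; exact h.away_of_link h1 h2 ih
  rcases h.simple θ with heq | hfull
  · exact (heq u u').mp (.single ⟨v, huv, huv'⟩)
  · exact absurd (hX x0 c0 (hfull _ _) h.memX) (notMem_away h.memC)

theorem T₀_inj_right (h : Config Ψ S C x0 c0) {u v v' : S.carrier} (huv : (u, v) ∈ T₀)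
    (huv' : (u, v') ∈ T₀) : v = v' :=
  h.T₀_inj (T₀_swap huv) (T₀_swap huv')

theorem exists_majority (h : Config Ψ S C x0 c0) (m : Term σ 3) (h1 : S.tri m x0 c0 c0 = c0)
    (h2 : S.tri m c0 x0 c0 = c0) (h3 : S.tri m c0 c0 x0 = c0) :
    ∃ m : Term σ 3, IsMajorityOn (S.tri m) {x0, c0} := by
  have dual : ∀ a b c a' b' c', (a, a') ∈ T₀ → (b, b') ∈ T₀ → (c, c') ∈ T₀ →
      S.tri m a b c = c0 → S.tri m a' b' c' = x0 := by
    intro a b c a' b' c' ha hb hc e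
    have := ((prod S S).closureSet_isClosed _).tri_mem m ha hb hc
    rw [tri_prod_mk, e] at this
    exact h.T₀_inj_right this cx_mem
  have d1 := dual _ _ _ _ _ _ xc_mem cx_mem cx_mem h1
  have d2 := dual _ _ _ _ _ _ cx_mem xc_mem cx_mem h2
  have d3 := dual _ _ _ _ _ _ cx_mem cx_mem xc_mem h3
  refine ⟨m, ?_⟩
  rintro x (rfl | rfl) y (rfl | rfl) <;>
    simp only [h.idem.tri_self, h1, h2, h3, d1, d2, d3, and_self]

theorem T_interpolate (h : Config Ψ S C x0 c0) {y y' : S.carrier} (hy : (y, y') ∈ T) :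
    ∃ u v, (u, v) ∈ T₀ ∧ (y, u) ∈ T ∧ (y', v) ∈ T := by
  have key : ∀ p : (prod S S).carrier, p ∈ T → ∃ u v, (u, v) ∈ T₀ ∧ (p.1, u) ∈ T ∧ (p.2, v) ∈ T := by
    intro p hp
    induction hp with
    | @base p hp =>
      rcases hp with hp | hp
      · exact ⟨x0, c0, xc_mem, mem_T_left hp _, mem_T_right h.memC _⟩
      · exact ⟨c0, x0, cx_mem, mem_T_right h.memC _, mem_T_left hp _⟩
    | app f x _ ih =>
      choose u v huv h1 h2 using ih
      have hcl := (prod S S).closureSet_isClosed {p : S.carrier × S.carrier | p.1 ∈ C ∨ p.2 ∈ C}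
      exact ⟨S.interp f u, S.interp f v,
        (prod S S).closureSet_isClosed _ f (fun j => (u j, v j)) huv,
        hcl f (fun j => ((x j).1, u j)) h1, hcl f (fun j => ((x j).2, v j)) h2⟩
  exact key _ hy

theorem isClosed_nbhd (h : Config Ψ S C x0 c0) (y : S.carrier) :
    S.IsClosed {w | (y, w) ∈ T} :=
  ((prod S S).closureSet_isClosed _).relFiber h.idem y

theorem hat_nbhd (h : Config Ψ S C x0 c0) {y : S.carrier} (hy : y ∈ Ĉ) (w : S.carrier) :
    (y, w) ∈ T := by
  obtain ⟨x, hx, hyx⟩ := hy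
  exact h.eq_univ (h.isClosed_nbhd y) hx h.memC hyx (mem_T_right h.memC y) w

theorem hat_notMem_away (h : Config Ψ S C x0 c0) {y : S.carrier} (hy : y ∈ Ĉ) : y ∉ X := by
  obtain ⟨x, hx, hyx⟩ := hy
  exact fun hX => h.sep _ _ hyx hX hx

theorem mem_hat (h : Config Ψ S C x0 c0) {c : S.carrier} (hc : c ∈ C) : c ∈ Ĉ :=
  ⟨x0, h.memX, mem_T_left hc _⟩

theorem hat_reach (h : Config Ψ S C x0 c0) {y z : S.carrier} (hy : y ∈ Ĉ)
    (hr : Reach Ψ S Set.univ y z) : z ∈ Ĉ := by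
  refine hr.mem_of_forall ?_ hy
  rintro u ⟨x, hx, hux⟩ s hs z -
  exact ⟨S.bin s x c0, away_reach S.isClosed_univ hx (.single ⟨s, hs, c0, trivial, rfl⟩),
    ((prod S S).closureSet_isClosed _).bin_pair_mem s hux (mem_T_right h.memC z)⟩

local notation "Q" => cyclicRel S x0 c0

theorem isHom_middle (S : UAlgebra σ) : IsHom (prod S (prod S S)) S fun q => q.2.1 := fun _ _ => rfl

theorem isHom_last (S : UAlgebra σ) : IsHom (prod S (prod S S)) S fun q => q.2.2 := fun _ _ => rfl

theorem cyclicRel_fst : (x0, c0, c0) ∈ Q := Closure.base (Or.inl rfl)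

theorem cyclicRel_snd : (c0, x0, c0) ∈ Q := Closure.base (Or.inr (Or.inl rfl))

theorem cyclicRel_trd : (c0, c0, x0) ∈ Q := Closure.base (Or.inr (Or.inr rfl))

theorem exists_majority_of_mem_Q (h : Config Ψ S C x0 c0) {d1 d2 d3 : S.carrier}
    (h1 : d1 ∈ C) (h2 : d2 ∈ C) (h3 : d3 ∈ C) (hd : (d1, d2, d3) ∈ Q) :
    ∃ m : Term σ 3, IsMajorityOn (S.tri m) {x0, c0} := by
  have hcl := (prod S (prod S S)).closureSet_isClosed {(x0, c0, c0), (c0, x0, c0), (c0, c0, x0)}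
  have hCC : (prod S S).IsClosed {p | p.1 ∈ C ∧ p.2 ∈ C} := fun f x hx =>
    ⟨h.closed f _ fun j => (hx j).1, h.closed f _ fun j => (hx j).2⟩
  obtain ⟨⟨w, w'⟩, ⟨hw, hw'⟩, hq⟩ := h.eq_univ (hcl.relImage hCC) h.memX h1
    ⟨(c0, c0), ⟨h.memC, h.memC⟩, cyclicRel_fst⟩ ⟨(d2, d3), ⟨h2, h3⟩, hd⟩ c0
  have hcl1 := hcl.relFiber h.idem c0
  obtain ⟨v, hv, hq⟩ := h.eq_univ (hcl1.relImage h.closed) h.memX hw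
    ⟨c0, h.memC, cyclicRel_snd⟩ ⟨w', hw', hq⟩ c0
  have hq := h.eq_univ (hcl1.relFiber h.idem c0) h.memX hv cyclicRel_trd hq c0
  obtain ⟨m, hm⟩ := mem_closureSet_triple.mp hq
  obtain ⟨e1, e⟩ := Prod.mk.inj ((tri_prod_prod_mk _ _ _ m _ _ _ _ _ _ _ _ _).symm.trans hm)
  obtain ⟨e2, e3⟩ := Prod.mk.inj e
  exact h.exists_majority m e1 e2 e3

theorem exists_majority_of_not_hat (h : Config Ψ S C x0 c0) {y y' : S.carrier}
    (hyy : (y, y') ∈ T) (hy : y ∉ Ĉ) (hy' : y' ∉ Ĉ) :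
    ∃ m : Term σ 3, IsMajorityOn (S.tri m) {x0, c0} := by
  obtain ⟨u, v, huv, hu, hv⟩ := h.T_interpolate hyy
  have hQ := (prod S (prod S S)).closureSet_isClosed {(x0, c0, c0), (c0, x0, c0), (c0, c0, x0)}
  have start : (u, v, c0) ∈ Q := by
    obtain ⟨t, ht⟩ := mem_closureSet_pair.mp huv
    rw [bin_prod_mk] at ht
    obtain ⟨rfl, rfl⟩ := Prod.mk.inj ht
    have e := bin_prod_prod_mk S S S t x0 c0 c0 x0 c0 c0
    rw [h.idem.bin_self] at e
    exact e ▸ hQ.bin_mem t cyclicRel_fst cyclicRel_snd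
  have drain : ∀ z, z ∉ Ĉ → ∀ w, (z, w) ∈ T →
      ∃ c ∈ C, Reach Ψ S (S.ClosureSet {w, c0}) w c := by
    intro z hz w hw
    refine h.drain _ (S.closureSet_isClosed _) (fun hu => hz ⟨x0, h.memX, ?_⟩)
      ⟨c0, right_mem_closureSet_pair _ _, h.memC⟩ w (left_mem_closureSet_pair _ _)
    have : x0 ∈ S.ClosureSet {w, c0} := by rw [hu]; trivial
    exact closureSet_pair_subset (h.isClosed_nbhd z) hw (mem_T_right h.memC z) this
  obtain ⟨c1, hc1, hr1⟩ := drain y hy u hu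
  rw [← (isHom_fst S (prod S S)).image_closureSet_pair (u, v, c0) (c0, c0, x0)] at hr1
  obtain ⟨⟨d, v1, c2⟩, hq, rfl⟩ := Reach.lift (u := (u, v, c0)) (isHom_fst S (prod S S)) hr1
  have hmem := hq.mem ((prod S (prod S S)).closureSet_isClosed _) subset_rfl (left_mem_closureSet_pair _ _)
  have hq1 : (d, v1, c2) ∈ Q := closureSet_pair_subset hQ start cyclicRel_trd hmem
  have hc2 : c2 ∈ C := h.up_reach h.memC ((hq.map (isHom_last S)).mono (Set.subset_univ _))
  have hv1 : (y', v1) ∈ T := by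
    have : v1 ∈ S.ClosureSet {v, c0} := by
      rw [← (isHom_middle S).image_closureSet_pair (u, v, c0) (c0, c0, x0)]
      exact ⟨_, hmem, rfl⟩
    exact closureSet_pair_subset (h.isClosed_nbhd y') hv (mem_T_right h.memC y') this
  obtain ⟨c3, hc3, hr3⟩ := drain y' hy' v1 hv1
  rw [← (isHom_middle S).image_closureSet_pair (d, v1, c2) (c0, c0, x0)] at hr3
  obtain ⟨⟨d1, d2, d3⟩, hq', rfl⟩ := Reach.lift (u := (d, v1, c2)) (isHom_middle S) hr3
  have hmem' := hq'.mem ((prod S (prod S S)).closureSet_isClosed _) subset_rfl (left_mem_closureSet_pair _ _)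
  exact h.exists_majority_of_mem_Q
    (h.up_reach hc1 ((hq'.map (isHom_fst S (prod S S))).mono (Set.subset_univ _))) hc3
    (h.up_reach hc2 ((hq'.map (isHom_last S)).mono (Set.subset_univ _)))
    (closureSet_pair_subset hQ hq1 cyclicRel_trd hmem')

theorem hat_iff (h : Config Ψ S C x0 c0) (hi : ∀ y y', (y, y') ∈ T → y ∈ Ĉ ∨ y' ∈ Ĉ)
    {u v : S.carrier} (huv : (u, v) ∈ T₀) : u ∈ Ĉ ↔ v ∉ Ĉ := by
  refine ⟨fun hu hv => ?_, fun hv => (hi u v (h.T₀_subset huv)).resolve_right hv⟩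
  obtain ⟨c1, hc1, hr1⟩ := exists_reach_of_notMem_away (Set.mem_univ _) (h.hat_notMem_away hu)
  obtain ⟨v1, hv1, hr2⟩ := h.T₀_lift huv hr1
  obtain ⟨c2, hc2, hr3⟩ :=
    exists_reach_of_notMem_away (Set.mem_univ _) (h.hat_notMem_away (h.hat_reach hv hr2))
  obtain ⟨w, hw, hr4⟩ := h.T₀_lift (T₀_swap hv1) hr3
  exact h.T₀_not_both hc2 (h.up_reach hc1 hr4) hw

theorem eq_or_eq (h : Config Ψ S C x0 c0) (hi : ∀ y y', (y, y') ∈ T → y ∈ Ĉ ∨ y' ∈ Ĉ)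
    (u : S.carrier) : u = x0 ∨ u = c0 := by
  have half : ∀ (f : σ.ops) (x y : Fin (σ.arity f) → S.carrier),
      (∀ j, x j ∈ Ĉ ↔ y j ∈ Ĉ) → S.interp f y ∈ Ĉ → S.interp f x ∈ Ĉ := by
    intro f x y hxy hfy
    choose y' hy' using fun j => h.T₀_total (y j)
    have hT : (S.interp f x, S.interp f y') ∈ T := by
      refine (prod S S).closureSet_isClosed _ f (fun j => (x j, y' j)) fun j => ?_
      by_cases hj : x j ∈ Ĉ
      · exact h.hat_nbhd hj _
      · refine T_swap (h.hat_nbhd ?_ _)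
        exact (h.hat_iff hi (T₀_swap (hy' j))).mpr ((hxy j).not.mp hj)
    refine (hi _ _ hT).resolve_right ((h.hat_iff hi ?_).mp hfy)
    exact (prod S S).closureSet_isClosed _ f (fun j => (y j, y' j)) hy'
  let κ : Congruence S :=
    { rel := fun u v => u ∈ Ĉ ↔ v ∈ Ĉ
      refl := fun _ => Iff.rfl
      symm := Iff.symm
      trans := Iff.trans
      compat := fun f x y hxy => ⟨half f y x fun j => (hxy j).symm, half f x y hxy⟩ }
  have hx0 : x0 ∉ Ĉ := fun hx => h.hat_notMem_away hx h.memX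
  have hc0 : c0 ∈ Ĉ := h.mem_hat h.memC
  rcases h.simple κ with heq | hfull
  · by_cases hu : u ∈ Ĉ
    · exact .inr ((heq u c0).mp ⟨fun _ => hc0, fun _ => hu⟩)
    · exact .inl ((heq u x0).mp ⟨fun hu' => absurd hu' hu, fun hx => absurd hx hx0⟩)
  · exact absurd ((hfull x0 c0).mpr hc0) hx0

open Classical in
theorem isSetAlgebra_or_exists_majority_of_hat (h : Config Ψ S C x0 c0)
    (hi : ∀ y y', (y, y') ∈ T → y ∈ Ĉ ∨ y' ∈ Ĉ) :
    S.IsSetAlgebra ∨ ∃ m : Term σ 3, IsMajorityOn (S.tri m) {x0, c0} := by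
  have two := h.eq_or_eq hi
  have hne : x0 ≠ c0 := by
    rintro rfl
    exact notMem_away h.memC h.memX
  by_cases hmaj : ∃ m : Term σ 3, IsMajorityOn (S.tri m) {x0, c0}
  · exact .inr hmaj
  refine .inl fun n t => ?_
  let ev (I : Finset (Fin n)) : S.carrier := t.eval S fun i => if i ∈ I then x0 else c0
  have dual : ∀ I, (ev I, ev Iᶜ) ∈ T₀ := by
    intro I
    refine ((prod S S).closureSet_isClosed _).eval_pair_mem t fun i => ?_
    change (_, _) ∈ T₀
    by_cases hi : i ∈ I
    · simpa [hi] using xc_mem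
    · simpa [hi] using cx_mem
  have disj : ∀ I J, Disjoint I J → ev I = x0 → ev J ≠ x0 := by
    intro I J hIJ hI hJ
    have : (ev I, ev J) ∈ T := by
      refine ((prod S S).closureSet_isClosed _).eval_pair_mem t fun i => ?_
      change (_, _) ∈ T
      by_cases hiI : i ∈ I
      · simpa [Finset.disjoint_left.mp hIJ hiI] using mem_T_right h.memC _
      · simpa [hiI] using mem_T_left h.memC _
    rw [hI, hJ] at this
    exact h.sep _ _ this h.memX h.memX
  have huniv : ev Finset.univ = x0 := by
    simpa [ev] using t.eval_const h.idem x0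
  have hempty : ev ∅ = c0 := by
    simpa [ev] using t.eval_const h.idem c0
  obtain ⟨I, hI, hmin⟩ := (Set.toFinite {I | ev I = x0}).exists_minimal ⟨_, huniv⟩
  have hIne : I.Nonempty := by
    rw [Finset.nonempty_iff_ne_empty]
    rintro rfl
    exact hne (hI.symm.trans hempty)
  obtain ⟨i, hiI⟩ := hIne
  have small : ∀ J, J ⊂ I → ev J = c0 := fun J hJ =>
    (two (ev J)).resolve_left fun hJ' => hJ.2 (hmin hJ' hJ.1)
  by_cases hI1 : I = {i}
  · refine ⟨i, fun x => ?_⟩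
    have hx : t.eval S x = ev {j | x j = x0} := by
      congr 1
      funext j
      rcases two (x j) with hj | hj <;> simp [hj, hne.symm]
    rw [hx]
    subst hI1
    rcases two (x i) with hj | hj
    · have h1 := disj {i} (Finset.filter (fun j => x j = x0) Finset.univ)ᶜ (by simp [hj]) hI
      have h2 := dual (Finset.filter (fun j => x j = x0) Finset.univ)
      rw [(two _).resolve_left h1] at h2
      rw [hj]
      exact h.T₀_inj h2 xc_mem
    · have h1 := disj {i} (Finset.filter (fun j => x j = x0) Finset.univ)
        (by simp [hj, hne.symm]) hI
      rw [hj]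
      exact (two _).resolve_left h1
  · refine absurd ?_ hmaj
    let m : Term σ 3 := t.subst fun j => if j = i then .var 0 else if j ∈ I then .var 1 else .var 2
    have hm : ∀ x y z, S.tri m x y z =
        t.eval S fun j => if j = i then x else if j ∈ I then y else z := by
      intro x y z
      rw [tri, Term.eval_subst]
      congr 1
      funext j
      split_ifs <;> rfl
    have h1 : S.tri m x0 c0 c0 = c0 := by
      have : ({i} : Finset (Fin n)) ⊂ I :=
        Finset.ssubset_iff_subset_ne.mpr ⟨by simpa using hiI, fun e => hI1 e.symm⟩
      rw [hm, ← small {i} this]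
      congr 1
      funext j
      simp [small {i} this]
    have h2 : S.tri m c0 x0 c0 = c0 := by
      have := small _ (Finset.erase_ssubset hiI)
      rw [hm]
      refine Eq.trans ?_ this
      congr 1
      funext j
      by_cases hj : j = i <;> simp [hj]
    have h3 : S.tri m x0 x0 c0 = x0 := by
      rw [hm]
      refine Eq.trans ?_ hI
      congr 1
      funext j
      by_cases hj : j = i <;> simp [hj, hiI]
    have h4 : S.tri m c0 c0 x0 = c0 := by
      have := ((prod S S).closureSet_isClosed {(x0, c0), (c0, x0)}).tri_mem m
        (xc_mem (x0 := x0) (c0 := c0)) xc_mem cx_mem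
      rw [tri_prod_mk, h3] at this
      exact h.T₀_inj_right this xc_mem
    exact h.exists_majority m h1 h2 h4

theorem isSetAlgebra_or_exists_majority (h : Config Ψ S C x0 c0) :
    S.IsSetAlgebra ∨ ∃ m : Term σ 3, IsMajorityOn (S.tri m) {x0, c0} := by
  by_cases hi : ∀ y y', (y, y') ∈ T → y ∈ Ĉ ∨ y' ∈ Ĉ
  · exact h.isSetAlgebra_or_exists_majority_of_hat hi
  · push Not at hi
    obtain ⟨y, y', hyy, hy, hy'⟩ := hi
    exact .inr (h.exists_majority_of_not_hat hyy hy hy')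

end Config

namespace Preconfig

variable {Ψ : Term σ 2 → Prop} {V S : UAlgebra σ} {C : Set V.carrier} {x0 c0 : V.carrier}

theorem map_ne (h : Preconfig Ψ V C x0 c0) {φ : V.carrier → S.carrier} (hφ : IsHom V S φ)
    (hS : S.Idempotent) (hne : φ x0 ≠ φ c0) {x c : V.carrier}
    (hx : x ∈ Away Ψ V Set.univ C) (hc : c ∈ C) : φ x ≠ φ c := by
  intro e
  have hcl := hφ.isClosed_preimage (hS.isClosed_singleton (φ c))
  have hall : ∀ y, φ y = φ c := fun y =>
    closureSet_pair_subset hcl e rfl (h.gen x hx c hc ▸ Set.mem_univ y)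
  exact hne ((hall x0).trans (hall c0).symm)

theorem map_mem_away_iff (h : Preconfig Ψ V C x0 c0) {φ : V.carrier → S.carrier}
    (hφ : IsHom V S φ) (hsurj : Function.Surjective φ) (hS : S.Idempotent)
    (hne : φ x0 ≠ φ c0) {x : V.carrier} :
    φ x ∈ Away Ψ S Set.univ (φ '' C) ↔ x ∈ Away Ψ V Set.univ C := by
  constructor
  · intro hx
    refine ⟨Set.mem_univ _, fun c hc hr => hx.2 (φ c) ⟨c, hc, rfl⟩ ?_⟩
    exact (hr.map hφ).mono (Set.subset_univ _)
  · intro hx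
    refine ⟨Set.mem_univ _, ?_⟩
    rintro _ ⟨c, hc, rfl⟩ hr
    rw [← Set.image_univ_of_surjective hsurj] at hr
    obtain ⟨v, hv, e⟩ := hr.lift hφ
    exact h.map_ne hφ hS hne (away_reach V.isClosed_univ hx hv) hc e

theorem map (h : Preconfig Ψ V C x0 c0) {φ : V.carrier → S.carrier} (hφ : IsHom V S φ)
    (hsurj : Function.Surjective φ) (hS : S.Idempotent) (hne : φ x0 ≠ φ c0) :
    Preconfig Ψ S (φ '' C) (φ x0) (φ c0) where
  idem := hS
  closed := hφ.isClosed_image h.closed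
  up := by
    rintro _ ⟨c, hc, rfl⟩ s hs z
    obtain ⟨z, rfl⟩ := hsurj z
    exact ⟨_, h.up c hc s hs z, hφ.bin s c z⟩
  memX := (h.map_mem_away_iff hφ hsurj hS hne).mpr h.memX
  memC := ⟨c0, h.memC, rfl⟩
  gen := by
    intro x hx
    obtain ⟨x, rfl⟩ := hsurj x
    rintro _ ⟨c, hc, rfl⟩
    rw [← hφ.image_closureSet_pair, h.gen x ((h.map_mem_away_iff hφ hsurj hS hne).mp hx) c hc,
      Set.image_univ_of_surjective hsurj]
  sep := by
    intro u v huv hu hv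
    have hφφ : IsHom (prod V V) (prod S S) (Prod.map φ φ) := fun f x =>
      Prod.ext (hφ f fun j => (x j).1) (hφ f fun j => (x j).2)
    have hsub : crossRel S (φ '' C) ⊆ Prod.map φ φ '' crossRel V C := by
      refine closureSet_subset
        (hφφ.isClosed_image ((prod V V).closureSet_isClosed _)) ?_
      rintro ⟨a, b⟩ hab
      obtain ⟨a, rfl⟩ := hsurj a
      obtain ⟨b, rfl⟩ := hsurj b
      rcases hab with ⟨c, hc, e⟩ | ⟨c, hc, e⟩
      · exact ⟨(c, b), Closure.base (Or.inl hc), Prod.ext e rfl⟩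
      · exact ⟨(a, c), Closure.base (Or.inr hc), Prod.ext rfl e⟩
    obtain ⟨⟨x, y⟩, hxy, e⟩ := hsub huv
    obtain ⟨rfl, rfl⟩ := Prod.mk.inj e
    exact h.sep x y hxy ((h.map_mem_away_iff hφ hsurj hS hne).mp hu)
      ((h.map_mem_away_iff hφ hsurj hS hne).mp hv)
  drain := by
    rintro D hD hDne ⟨_, hcD, c, hc, rfl⟩ u hu
    obtain ⟨u, rfl⟩ := hsurj u
    obtain ⟨c', hc', hr⟩ := h.drain (φ ⁻¹' D) (hφ.isClosed_preimage hD)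
      (fun e => hDne (by rw [← Set.image_preimage_eq D hsurj, e,
        Set.image_univ_of_surjective hsurj])) ⟨c, hcD, hc⟩ u hu
    exact ⟨φ c', ⟨c', hc', rfl⟩, (hr.map hφ).mono (Set.image_preimage_subset φ D)⟩

end Preconfig

section Subalg

variable {P : UAlgebra σ} {E : Set P.carrier} (hE : P.IsClosed E)

theorem isHom_subalg_val : IsHom (P.subalg E hE) P Subtype.val := fun _ _ => rfl

theorem Idempotent.subalg (hP : P.Idempotent) : (P.subalg E hE).Idempotent :=
  fun f a => Subtype.ext (hP f a.1)

theorem reach_subalg_iff {Ψ : Term σ 2 → Prop} {D : Set (P.subalg E hE).carrier}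
    {u v : (P.subalg E hE).carrier} :
    Reach Ψ (P.subalg E hE) D u v ↔ Reach Ψ P (Subtype.val '' D) u.1 v.1 := by
  constructor
  · exact fun h => h.map (isHom_subalg_val hE)
  · intro h
    obtain ⟨w, hw, e⟩ := h.lift (isHom_subalg_val hE)
    rwa [← Subtype.ext e]

theorem image_val_univ_subalg :
    Subtype.val '' (Set.univ : Set (P.subalg E hE).carrier) = E :=
  Set.image_univ.trans Subtype.range_coe

theorem mem_away_subalg_iff {Ψ : Term σ 2 → Prop} {C : Set P.carrier}
    {u : (P.subalg E hE).carrier} :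
    u ∈ Away Ψ (P.subalg E hE) Set.univ (Subtype.val ⁻¹' C) ↔ u.1 ∈ Away Ψ P E C := by
  constructor
  · refine fun h => ⟨u.2, fun c hc hr => ?_⟩
    refine h.2 ⟨c, hr.mem hE subset_rfl u.2⟩ hc ((reach_subalg_iff hE).mpr ?_)
    rwa [image_val_univ_subalg]
  · refine fun h => ⟨Set.mem_univ _, fun c hc hr => h.2 c.1 hc ?_⟩
    have := (reach_subalg_iff hE).mp hr
    rwa [image_val_univ_subalg] at this

theorem preconfig_subalg {Ψ : Term σ 2 → Prop} {C : Set P.carrier}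
    {x0 c0 : (P.subalg E hE).carrier} (hP : P.Idempotent) (hC : P.IsClosed C)
    (up : ∀ c ∈ C, ∀ s, Ψ s → ∀ z ∈ E, P.bin s c z ∈ C)
    (memX : x0.1 ∈ Away Ψ P E C) (memC : c0.1 ∈ C)
    (gen : ∀ x ∈ Away Ψ P E C, ∀ c ∈ C, c ∈ E → E ⊆ P.ClosureSet {x, c})
    (sep : ∀ u v, (u, v) ∈ (prod P P).ClosureSet
        {p : P.carrier × P.carrier | p.1 ∈ E ∧ p.2 ∈ E ∧ (p.1 ∈ C ∨ p.2 ∈ C)} →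
      u ∈ Away Ψ P E C → v ∉ Away Ψ P E C)
    (drain : ∀ D, P.IsClosed D → D ⊂ E → (D ∩ C).Nonempty → ∀ u ∈ D,
      ∃ c ∈ C, Reach Ψ P D u c) :
    Preconfig Ψ (P.subalg E hE) (Subtype.val ⁻¹' C) x0 c0 where
  idem := hP.subalg hE
  closed := (isHom_subalg_val hE).isClosed_preimage hC
  up c hc s hs z := by
    have := up c.1 hc s hs z.1 z.2
    rwa [← (isHom_subalg_val hE).bin] at this
  memX := (mem_away_subalg_iff hE).mpr memX
  memC := memC
  gen x hx c hc := by
    refine Set.eq_univ_of_forall fun y => ?_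
    have := gen x.1 ((mem_away_subalg_iff hE).mp hx) c.1 hc c.2 y.2
    rw [← (isHom_subalg_val hE).image_closureSet_pair] at this
    obtain ⟨y', hy', e⟩ := this
    rwa [← Subtype.ext e]
  sep u v huv hu hv := by
    refine sep u.1 v.1 ?_ ((mem_away_subalg_iff hE).mp hu) ((mem_away_subalg_iff hE).mp hv)
    have hφφ : IsHom (prod (P.subalg E hE) (P.subalg E hE)) (prod P P)
        (Prod.map Subtype.val Subtype.val) := fun _ _ => rfl
    have hcl := hφφ.isClosed_preimage ((prod P P).closureSet_isClosed
      {p : P.carrier × P.carrier | p.1 ∈ E ∧ p.2 ∈ E ∧ (p.1 ∈ C ∨ p.2 ∈ C)})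
    exact closureSet_subset hcl (fun p hp => Closure.base ⟨p.1.2, p.2.2, hp⟩) huv
  drain D hD hDne hDC u hu := by
    have hval : Subtype.val '' D ⊆ E := by rintro _ ⟨y, _, rfl⟩; exact y.2
    obtain ⟨d, hd, hdC⟩ := hDC
    obtain ⟨c, hc, hr⟩ := drain (Subtype.val '' D) ((isHom_subalg_val hE).isClosed_image hD)
      (hval.ssubset_of_ne fun e => hDne <| Set.eq_univ_of_forall fun y => by
        have hy : y.1 ∈ Subtype.val '' D := e.symm.subset y.2
        obtain ⟨y', hy', ey⟩ := hy
        rwa [← Subtype.ext ey])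
      ⟨d.1, ⟨d, hd, rfl⟩, hdC⟩ u.1 ⟨u, hu, rfl⟩
    have hcE : c ∈ E := hr.mem hE hval u.2
    exact ⟨⟨c, hcE⟩, hc, (reach_subalg_iff hE).mpr hr⟩

end Subalg

/-! ### Quotients -/

theorem isHom_quot_mk (A : UAlgebra σ) (θ : Congruence A) :
    IsHom A (A.quot θ) (Quotient.mk θ.toSetoid) := fun f x =>
  Quotient.sound (θ.compat f _ _ fun j =>
    θ.symm (Quotient.exact (s := θ.toSetoid) (Quotient.out_eq (Quotient.mk θ.toSetoid (x j)))))

theorem Idempotent.quot {A : UAlgebra σ} (hA : A.Idempotent) (θ : Congruence A) :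
    (A.quot θ).Idempotent := by
  intro f a
  change Quotient.mk θ.toSetoid (A.interp f fun _ => a.out) = a
  rw [hA f]
  exact Quotient.out_eq a

/-- The inverse image of a congruence under a homomorphism. -/
def Congruence.comap {A B : UAlgebra σ} {φ : A.carrier → B.carrier} (hφ : IsHom A B φ)
    (η : Congruence B) : Congruence A where
  rel x y := η.rel (φ x) (φ y)
  refl _ := η.refl _
  symm := η.symm
  trans := η.trans
  compat f x y h := by
    rw [hφ, hφ]
    exact η.compat f _ _ h

/-- The equality congruence. -/
def Congruence.equality (A : UAlgebra σ) : Congruence A where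
  rel x y := x = y
  refl _ := rfl
  symm := Eq.symm
  trans := Eq.trans
  compat f x y h := by rw [show x = y from funext h]

/-- The direct image of a congruence containing the kernel of a surjective homomorphism. -/
def Congruence.image {A B : UAlgebra σ} {φ : A.carrier → B.carrier} (hφ : IsHom A B φ)
    (hsurj : Function.Surjective φ) (η : Congruence A)
    (hker : ∀ x y, φ x = φ y → η.rel x y) : Congruence B where
  rel s t := ∃ x y, φ x = s ∧ φ y = t ∧ η.rel x y
  refl s := by
    obtain ⟨x, rfl⟩ := hsurj s
    exact ⟨x, x, rfl, rfl, η.refl x⟩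
  symm := by
    rintro _ _ ⟨x, y, rfl, rfl, h⟩
    exact ⟨y, x, rfl, rfl, η.symm h⟩
  trans := by
    rintro _ _ _ ⟨x, y, rfl, rfl, h⟩ ⟨y', z, e, rfl, h'⟩
    exact ⟨x, z, rfl, rfl, η.trans h (η.trans (hker _ _ e.symm) h')⟩
  compat f s t h := by
    choose x y hx hy hxy using h
    refine ⟨A.interp f x, A.interp f y, ?_, ?_, η.compat f x y hxy⟩
    · rw [hφ]; simp only [hx]
    · rw [hφ]; simp only [hy]

theorem Congruence.IsMaximal.isSimple_quot {A : UAlgebra σ} {θ : Congruence A}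
    (h : θ.IsMaximal) : (A.quot θ).IsSimple := by
  intro η
  by_cases hfull : η.IsFull
  · exact .inr hfull
  · left
    have hle := h.2 (η.comap (isHom_quot_mk A θ))
      (fun x y hxy => by
        change η.rel _ _
        rw [Quotient.sound (s := θ.toSetoid) hxy]
        exact η.refl _)
      (fun hf => hfull fun x y => by
        induction x using Quotient.inductionOn
        induction y using Quotient.inductionOn
        exact hf _ _)
    intro x y
    constructor
    · intro hxy
      induction x using Quotient.inductionOn
      induction y using Quotient.inductionOn
      exact Quotient.sound (s := θ.toSetoid) (hle _ _ hxy)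
    · rintro rfl
      exact η.refl _

theorem Congruence.isMaximal_comap_equality {A S : UAlgebra σ} {φ : A.carrier → S.carrier}
    (hφ : IsHom A S φ) (hsurj : Function.Surjective φ) (hS : S.IsSimple)
    {a b : A.carrier} (hab : φ a ≠ φ b) :
    ((Congruence.equality S).comap hφ).IsMaximal := by
  refine ⟨fun h => hab (h a b), fun η hle hη x y hxy => ?_⟩
  rcases hS (η.image hφ hsurj hle) with h | h
  · exact (h (φ x) (φ y)).mp ⟨x, y, rfl, rfl, hxy⟩
  · refine absurd (fun u v => ?_) hη
    obtain ⟨x, y, hx, hy, hxy⟩ := h (φ u) (φ v)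
    exact η.trans (hle _ _ hx.symm) (η.trans hxy (hle _ _ hy))

theorem exists_isMaximal (A : UAlgebra σ) [Finite A.carrier] {a b : A.carrier} (hab : a ≠ b) :
    ∃ θ : Congruence A, θ.IsMaximal := by
  let G : Congruence A → Set (A.carrier × A.carrier) := fun θ => {p | θ.rel p.1 p.2}
  have hfin : (G '' {θ | ¬ θ.IsFull}).Finite := Set.toFinite _
  obtain ⟨_, ⟨θ, hθ, rfl⟩, hmax⟩ := hfin.exists_maximal
    ⟨_, Congruence.equality A, fun h => hab (h a b), rfl⟩
  refine ⟨θ, hθ, fun η hle hη x y hxy => ?_⟩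
  exact hmax ⟨η, hη, rfl⟩ (fun p hp => hle p.1 p.2 hp) (show (x, y) ∈ G η from hxy)

theorem IsSetAlgebra.of_injective {A B : UAlgebra σ} {φ : A.carrier → B.carrier}
    (hφ : IsHom A B φ) (hinj : Function.Injective φ) (hB : B.IsSetAlgebra) :
    A.IsSetAlgebra := by
  intro n t
  obtain ⟨i, hi⟩ := hB n t
  exact ⟨i, fun x => hinj ((hφ.eval t x).trans (hi _))⟩

theorem isUnaryEdge_of_isHom {A S : UAlgebra σ} {a b : A.carrier}
    {φ : (A.Sg {a, b}).carrier → S.carrier} (hφ : IsHom (A.Sg {a, b}) S φ)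
    (hsurj : Function.Surjective φ) (hS : S.IsSimple) (hset : S.IsSetAlgebra)
    (hne : φ (A.sgA a b) ≠ φ (A.sgB a b)) : A.IsUnaryEdge a b := by
  refine ⟨fun e => hne (congrArg φ (Subtype.ext e)), (Congruence.equality S).comap hφ,
    Congruence.isMaximal_comap_equality hφ hsurj hS hne, ?_⟩
  set θ := (Congruence.equality S).comap hφ
  let ψ : ((A.Sg {a, b}).quot θ).carrier → S.carrier :=
    Quotient.lift (s := θ.toSetoid) φ fun _ _ h => h
  have hψ : ∀ q, φ (Quotient.out (s := θ.toSetoid) q) = ψ q := fun q =>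
    congrArg ψ (Quotient.out_eq (s := θ.toSetoid) q)
  refine IsSetAlgebra.of_injective (φ := ψ) ?_ ?_ hset
  · intro f x
    refine (hφ f _).trans ?_
    congr 1
    funext j
    exact hψ (x j)
  · intro p q
    induction p using Quotient.inductionOn
    induction q using Quotient.inductionOn
    exact fun h => Quotient.sound (s := θ.toSetoid) h

theorem OmitsType1.false_of_isHom {A S : UAlgebra σ} (h1 : A.OmitsType1) {a b : A.carrier}
    {φ : (A.Sg {a, b}).carrier → S.carrier} (hφ : IsHom (A.Sg {a, b}) S φ)
    (hsurj : Function.Surjective φ) (hS : S.IsSimple) (hset : S.IsSetAlgebra)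
    (hne : φ (A.sgA a b) ≠ φ (A.sgB a b)) : False := by
  have hval := isHom_subalg_val A.isClosed_univ
  let a' : (A.subalg Set.univ A.isClosed_univ).carrier := ⟨a, trivial⟩
  let b' : (A.subalg Set.univ A.isClosed_univ).carrier := ⟨b, trivial⟩
  have himg := hval.image_closureSet_pair a' b'
  let ψ : ((A.subalg Set.univ A.isClosed_univ).Sg {a', b'}).carrier → (A.Sg {a, b}).carrier :=
    fun x => ⟨x.1.1, himg.subset ⟨x.1, x.2, rfl⟩⟩
  refine h1 Set.univ A.isClosed_univ a' b'
    (isUnaryEdge_of_isHom (φ := fun x => φ (ψ x)) ?_ ?_ hS hset hne)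
  · exact fun f x => hφ f fun j => ψ (x j)
  · refine hsurj.comp fun y => ?_
    obtain ⟨x, hx, e⟩ := himg.symm.subset y.2
    exact ⟨⟨x, hx⟩, Subtype.ext e⟩

theorem Preconfig.false_of_isHom {A V : UAlgebra σ} [Finite A.carrier] (hA : A.Idempotent)
    (h1 : A.OmitsType1) (hmf : A.MajorityFree) {C : Set V.carrier} {x0 c0 : V.carrier}
    (h : Preconfig A.IsPartialSL V C x0 c0) {p : V.carrier → A.carrier} (hp : IsHom V A p)
    (hne : p x0 ≠ p c0) : False := by
  set a := p x0 with ha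
  set b := p c0 with hb
  have himg : p '' Set.univ = A.ClosureSet {a, b} := by
    rw [← h.gen x0 h.memX c0 h.memC, hp.image_closureSet_pair]
  let φ : V.carrier → (A.Sg {a, b}).carrier := fun x => ⟨p x, himg.subset ⟨x, trivial, rfl⟩⟩
  have hφ : IsHom V (A.Sg {a, b}) φ := fun f x => Subtype.ext (hp f x)
  have hφs : Function.Surjective φ := fun y => by
    obtain ⟨x, -, e⟩ := himg.symm.subset y.2
    exact ⟨x, Subtype.ext e⟩
  have : Finite (A.Sg {a, b}).carrier := Subtype.finite
  have hab : A.sgA a b ≠ A.sgB a b := fun e => hne (congrArg Subtype.val e)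
  obtain ⟨θ, hθ⟩ := exists_isMaximal (A.Sg {a, b}) hab
  have hmk := isHom_quot_mk (A.Sg {a, b}) θ
  have hmks : Function.Surjective (Quotient.mk θ.toSetoid) := Quotient.mk_surjective
  have hq : IsHom V ((A.Sg {a, b}).quot θ) fun x => Quotient.mk θ.toSetoid (φ x) := fun f x =>
    (congrArg _ (hφ f x)).trans (hmk f _)
  have hS : ((A.Sg {a, b}).quot θ).Idempotent := (hA.subalg _).quot θ
  have hqne : A.qa a b θ ≠ A.qb a b θ := by
    intro e
    refine hθ.1 fun u v => ?_
    have hall : ∀ u, Quotient.mk θ.toSetoid u = A.qb a b θ := by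
      intro u
      obtain ⟨x, rfl⟩ := hφs u
      have hcl := hq.isClosed_preimage (hS.isClosed_singleton (A.qb a b θ))
      exact closureSet_pair_subset hcl e rfl (h.gen x0 h.memX c0 h.memC ▸ Set.mem_univ x)
    exact Quotient.exact (s := θ.toSetoid) ((hall u).trans (hall v).symm)
  have hcfg : Config A.IsPartialSL ((A.Sg {a, b}).quot θ) _ (A.qa a b θ) (A.qb a b θ) :=
    { h.map hq (hmks.comp hφs) hS hqne with
      simple := hθ.isSimple_quot
      absorb := by
        intro f x c hxc hcx
        obtain ⟨s, hs, hD⟩ := exists_isPartialSL hA f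
        refine ⟨s, hs, hD _ {c} x c rfl ?_ ?_ ?_⟩
        · rintro _ rfl; exact hxc
        · rintro _ rfl; exact hcx
        · rintro _ rfl _ rfl; exact hS.bin_self f _ }
  rcases hcfg.isSetAlgebra_or_exists_majority with hset | ⟨m, hm⟩
  · exact h1.false_of_isHom hmk hmks hθ.isSimple_quot hset hqne
  · exact hmf a b ⟨hne, θ, hθ, ⟨m, hm⟩, fun ⟨t, ht⟩ => hcfg.no_semilattice t ht⟩

/-- The subalgebra of `P × P` generated by `(a, b)`, `(b, b)` and `(b, a)`. -/
abbrev forkRel (P : UAlgebra σ) (a b : P.carrier) : Set (P.carrier × P.carrier) :=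
  (prod P P).ClosureSet {(a, b), (b, b), (b, a)}

/-- The elements of `Sg {a, b}` related by `forkRel` to all of `Sg {a, b}`. -/
def forkCenter (P : UAlgebra σ) (a b : P.carrier) : Set P.carrier :=
  {u | u ∈ P.ClosureSet {a, b} ∧ ∀ w ∈ P.ClosureSet {a, b}, (u, w) ∈ forkRel P a b}

section Fork

variable {P : UAlgebra σ} {a b : P.carrier}

theorem forkRel_symm {u v : P.carrier} (h : (u, v) ∈ forkRel P a b) :
    (v, u) ∈ forkRel P a b := by
  refine mem_closureSet_swap (fun u v h => ?_) h
  rcases h with h | h | h <;> obtain ⟨rfl, rfl⟩ := Prod.mk.inj h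
  · exact .inr (.inr rfl)
  · exact .inr (.inl rfl)
  · exact .inl rfl

theorem isClosed_forkRel_fiber (hP : P.Idempotent) (x : P.carrier) :
    P.IsClosed {w | (x, w) ∈ forkRel P a b} :=
  ((prod P P).closureSet_isClosed {(a, b), (b, b), (b, a)}).relFiber hP x

theorem right_mem_forkCenter (hP : P.Idempotent) : b ∈ forkCenter P a b :=
  ⟨right_mem_closureSet_pair a b, fun _ hw =>
    closureSet_pair_subset (isClosed_forkRel_fiber hP b) (Closure.base (.inr (.inr rfl)))
      (Closure.base (.inr (.inl rfl))) hw⟩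

theorem isClosed_forkCenter (hP : P.Idempotent) : P.IsClosed (forkCenter P a b) := by
  intro f x hx
  refine ⟨P.closureSet_isClosed _ f x fun j => (hx j).1, fun w hw => forkRel_symm ?_⟩
  exact isClosed_forkRel_fiber hP w f x fun j => forkRel_symm ((hx j).2 w hw)

/-- `Sg {a, b}` has no proper nonempty subset absorbing it with respect to a binary term. -/
def NoAbsorption (P : UAlgebra σ) (a b : P.carrier) : Prop :=
  ∀ (f : Term σ 2) (D : Set P.carrier), P.IsClosed D → D ⊆ P.ClosureSet {a, b} → D.Nonempty →
    (∀ d ∈ D, ∀ w ∈ P.ClosureSet {a, b}, P.bin f d w ∈ D ∧ P.bin f w d ∈ D) →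
    P.ClosureSet {a, b} ⊆ D

theorem NoAbsorption.mem_forkCenter (h : NoAbsorption P a b) (hP : P.Idempotent) (f : Term σ 2)
    {v : P.carrier} (hv : v ∈ P.ClosureSet {a, b})
    (habs : ∀ d ∈ P.ClosureSet {a, b}, (v, d) ∈ forkRel P a b → ∀ w ∈ P.ClosureSet {a, b},
      (v, P.bin f d w) ∈ forkRel P a b ∧ (v, P.bin f w d) ∈ forkRel P a b) :
    v ∈ forkCenter P a b := by
  have hcl := P.closureSet_isClosed {a, b}
  have := h f (P.ClosureSet {a, b} ∩ {w | (v, w) ∈ forkRel P a b})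
    (hcl.inter (isClosed_forkRel_fiber hP v)) Set.inter_subset_left
    ⟨b, right_mem_closureSet_pair a b, forkRel_symm ((right_mem_forkCenter hP).2 v hv)⟩
    fun d hd w hw => ⟨⟨hcl.bin_mem f hd.1 hw, (habs d hd.1 hd.2 w hw).1⟩,
      ⟨hcl.bin_mem f hw hd.1, (habs d hd.1 hd.2 w hw).2⟩⟩
  exact ⟨hv, fun w hw => (this hw).2⟩

theorem NoAbsorption.bin_mem_forkCenter (h : NoAbsorption P a b) (hP : P.Idempotent)
    {s : Term σ 2} (hs : P.IsPartialSL s) {c z : P.carrier} (hc : c ∈ forkCenter P a b)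
    (hz : z ∈ P.ClosureSet {a, b}) : P.bin s c z ∈ forkCenter P a b := by
  have hR := (prod P P).closureSet_isClosed {(a, b), (b, b), (b, a)}
  refine h.mem_forkCenter hP s ((P.closureSet_isClosed _).bin_mem s hc.1 hz)
    fun d _ hvd w hw => ⟨?_, ?_⟩
  · have := hR.bin_pair_mem s hvd (hc.2 w hw)
    rwa [(hs c z).2] at this
  · have := hR.bin_pair_mem s (hc.2 w hw) hvd
    rwa [(hs c z).1] at this

theorem NoAbsorption.separated [Finite P.carrier] (h : NoAbsorption P a b) (hP : P.Idempotent)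
    {E Y : Set P.carrier} (hEB : E ⊆ P.ClosureSet {a, b}) (hYE : Y ⊆ E)
    (hY : ∀ y ∈ Y, y ∉ forkCenter P a b)
    (hle : ∀ y ∈ Y, ∀ x ∈ E, ∀ w ∈ P.ClosureSet {a, b},
      (y, w) ∈ forkRel P a b → (x, w) ∈ forkRel P a b) (u v : P.carrier)
    (huv : (u, v) ∈ (prod P P).ClosureSet {p : P.carrier × P.carrier |
      p.1 ∈ E ∧ p.2 ∈ E ∧ (p.1 ∈ forkCenter P a b ∨ p.2 ∈ forkCenter P a b)})
    (hu : u ∈ Y) : v ∉ Y := by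
  intro hv
  classical
  have hR := (prod P P).closureSet_isClosed {(a, b), (b, b), (b, a)}
  set G := {p : P.carrier × P.carrier |
      p.1 ∈ E ∧ p.2 ∈ E ∧ (p.1 ∈ forkCenter P a b ∨ p.2 ∈ forkCenter P a b)}
  obtain ⟨n, g, hg⟩ : ∃ (n : ℕ) (g : Fin n → P.carrier × P.carrier), Set.range g = G := by
    obtain ⟨n, ⟨e⟩⟩ := Finite.exists_equiv_fin G
    exact ⟨n, fun i => (e.symm i).1, by
      rw [Set.range_comp' Subtype.val e.symm, e.symm.range_eq_univ]; simp⟩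
  have hgG : ∀ i, g i ∈ G := fun i => hg ▸ Set.mem_range_self i
  obtain ⟨t, ht⟩ := (mem_closureSet_range (A := prod P P)).mp
    (closureSet_mono (prod P P) hg.symm.subset huv)
  have ht' := (eval_prod P P t g).symm.trans ht
  obtain ⟨htu, htv⟩ := Prod.mk.inj ht'
  let f : Term σ 2 := t.subst fun i =>
    if (g i).1 ∈ forkCenter P a b then .var 0 else .var 1
  have hf : ∀ p q, P.bin f p q =
      t.eval P fun i => if (g i).1 ∈ forkCenter P a b then p else q := by
    intro p q
    rw [bin, Term.eval_subst]
    congr 1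
    funext i
    split_ifs <;> rfl
  refine hY u hu (h.mem_forkCenter hP f (hEB (hYE hu)) fun d hd hud w hw => ⟨?_, ?_⟩)
  · refine hle v hv u (hYE hu) _ ((P.closureSet_isClosed _).bin_mem f hd hw) ?_
    rw [hf]
    nth_rw 1 [← htv]
    refine hR.eval_pair_mem t fun i => ?_
    split_ifs with hi
    · exact hle u hu _ (hgG i).2.1 d hd hud
    · exact ((hgG i).2.2.resolve_left hi).2 w hw
  · rw [hf]
    nth_rw 1 [← htu]
    refine hR.eval_pair_mem t fun i => ?_
    split_ifs with hi
    · exact hi.2 w hw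
    · exact hle u hu _ (hgG i).1 d hd hud

theorem NoAbsorption.exists_reach {A : UAlgebra σ} [Finite A.carrier] [Finite P.carrier]
    (hA : A.Idempotent) (h1 : A.OmitsType1) (hmf : A.MajorityFree) (hP : P.Idempotent)
    (hsep : ∀ x y : P.carrier, x ≠ y → ∃ p : P.carrier → A.carrier, IsHom P A p ∧ p x ≠ p y)
    (hSL : ∀ s, A.IsPartialSL s → P.IsPartialSL s) (h : NoAbsorption P a b) :
    ∃ c ∈ forkCenter P a b, Reach A.IsPartialSL P (P.ClosureSet {a, b}) a c := by
  set B := P.ClosureSet {a, b} with hB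
  set C := forkCenter P a b with hC
  by_contra! hno
  let F : Set (Set P.carrier) := {E | P.IsClosed E ∧ E ⊆ B ∧
    (Away A.IsPartialSL P E C).Nonempty ∧ (E ∩ C).Nonempty}
  obtain ⟨E, ⟨hE, hEB, ⟨x, hx⟩, ⟨c, hcE, hcC⟩⟩, hmin⟩ := (Set.toFinite F).exists_minimal
    ⟨B, P.closureSet_isClosed _, subset_rfl, ⟨a, left_mem_closureSet_pair a b, hno⟩,
      ⟨b, right_mem_closureSet_pair a b, right_mem_forkCenter hP⟩⟩
  have hmin' : ∀ D, P.IsClosed D → D ⊆ E → (Away A.IsPartialSL P D C).Nonempty →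
      (D ∩ C).Nonempty → E ⊆ D := fun D h1 h2 h3 h4 => hmin ⟨h1, h2.trans hEB, h3, h4⟩ h2
  have gen : ∀ x ∈ Away A.IsPartialSL P E C, ∀ c ∈ C, c ∈ E → E ⊆ P.ClosureSet {x, c} := by
    intro x hx c hc hcE
    have hsub := closureSet_pair_subset hE hx.1 hcE
    exact hmin' _ (P.closureSet_isClosed _) hsub
      ⟨x, left_mem_closureSet_pair x c, fun c' hc' hr => hx.2 c' hc' (hr.mono hsub)⟩
      ⟨c, right_mem_closureSet_pair x c, hc⟩
  have hXC : ∀ y ∈ Away A.IsPartialSL P E C, y ∉ C := fun y hy hyC => hy.2 y hyC .refl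
  have hpre : Preconfig A.IsPartialSL (P.subalg E hE) (Subtype.val ⁻¹' C)
      ⟨x, hx.1⟩ ⟨c, hcE⟩ := by
    refine preconfig_subalg hE hP (isClosed_forkCenter hP)
      (fun c hc s hs z hz => h.bin_mem_forkCenter hP (hSL s hs) hc (hEB hz)) hx hcC gen
      (h.separated hP hEB (fun y hy => hy.1) hXC fun y hy x' hx' w hw hyw => ?_) ?_
    · have := closureSet_pair_subset (isClosed_forkRel_fiber hP w) (forkRel_symm hyw)
        (forkRel_symm (hcC.2 w hw)) (gen y hy c hcC hcE hx')
      exact forkRel_symm this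
    · intro D hD hDE hDC u hu
      by_contra! hr
      exact hDE.2 (hmin' D hD hDE.1 ⟨u, hu, hr⟩ hDC)
  obtain ⟨p, hp, hne⟩ := hsep x c fun e => hXC x hx (e ▸ hcC)
  exact hpre.false_of_isHom hA h1 hmf
    (p := fun y => p y.1) (fun f y => hp f fun j => (y j).1) hne

end Fork

section Square

variable {A : UAlgebra σ}

/-- The power of `A` indexed by the pairs of elements of `A`. -/
abbrev squarePower (A : UAlgebra σ) : UAlgebra σ := pi fun _ : A.carrier × A.carrier => A

/-- Transposition of the index pairs. -/
def transpose (u : (squarePower A).carrier) : (squarePower A).carrier := fun k => u k.swap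

theorem isHom_transpose (A : UAlgebra σ) :
    IsHom (squarePower A) (squarePower A) transpose := fun _ _ => rfl

theorem transpose_transpose (u : (squarePower A).carrier) : transpose (transpose u) = u := rfl

/-- The families `u` with `u (i, j)` reachable from `i`. -/
def reachable (A : UAlgebra σ) : Set (squarePower A).carrier :=
  {u | ∀ k, A.sReach k.1 (u k)}

theorem bin_mem_reachable (hA : A.Idempotent) {s : Term σ 2} (hs : A.IsPartialSL s)
    {u : (squarePower A).carrier} (hu : u ∈ reachable A) (z : (squarePower A).carrier) :
    (squarePower A).bin s u z ∈ reachable A := by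
  intro k
  rw [(isHom_proj (fun _ => A) k).bin]
  exact (hu k).tail (hs.isThinSLEdge hA _ _)

theorem transpose_mem_closureSet {u w : (squarePower A).carrier}
    (hw : w ∈ (squarePower A).ClosureSet {u, transpose u}) :
    transpose w ∈ (squarePower A).ClosureSet {u, transpose u} :=
  closureSet_pair_subset
    ((isHom_transpose A).isClosed_preimage ((squarePower A).closureSet_isClosed _))
    (right_mem_closureSet_pair u (transpose u)) (left_mem_closureSet_pair u (transpose u)) hw

theorem noAbsorption_of_minimal [Finite A.carrier] (hA : A.Idempotent)
    {a : (squarePower A).carrier} (ha : a ∈ reachable A)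
    (hmin : ∀ a' ∈ reachable A, a' ∈ (squarePower A).ClosureSet {a, transpose a} →
      transpose a' ∈ (squarePower A).ClosureSet {a, transpose a} →
      (squarePower A).ClosureSet {a, transpose a} ⊆
        (squarePower A).ClosureSet {a', transpose a'}) :
    NoAbsorption (squarePower A) a (transpose a) := by
  rintro f D hD hDB ⟨d, hd⟩ habs
  have haB := left_mem_closureSet_pair (A := squarePower A) a (transpose a)
  have ht := isHom_transpose A
  have hbin : ∀ d ∈ D ∩ transpose ⁻¹' D,
      ∀ w ∈ (squarePower A).ClosureSet {a, transpose a},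
      (squarePower A).bin f d w ∈ D ∩ transpose ⁻¹' D ∧
      (squarePower A).bin f w d ∈ D ∩ transpose ⁻¹' D := by
    intro d hd w hw
    have h1 := habs d hd.1 w hw
    have h2 := habs (transpose d) hd.2 (transpose w) (transpose_mem_closureSet hw)
    rw [← ht.bin, ← ht.bin] at h2
    exact ⟨⟨h1.1, h2.1⟩, ⟨h1.2, h2.2⟩⟩
  have hd' := transpose_mem_closureSet (hDB hd)
  have he : (squarePower A).bin f d (transpose d) ∈ D ∩ transpose ⁻¹' D := by
    refine ⟨(habs d hd _ hd').1, ?_⟩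
    rw [Set.mem_preimage, ht.bin, transpose_transpose]
    exact (habs d hd _ hd').2
  obtain ⟨s, hs, hsD⟩ := exists_isPartialSL hA f
  have ha' := hsD (squarePower A) _ a _ he (fun d hd => (hbin d hd a haB).2)
    (fun d hd => (hbin d hd a haB).1) fun d hd d' hd' => (hbin d hd d' (hDB hd'.1)).1
  exact (hmin _ (bin_mem_reachable hA hs ha _) (hDB ha'.1) (hDB ha'.2)).trans
    (closureSet_pair_subset hD ha'.1 ha'.2)

theorem exists_reachable_maltsev [Finite A.carrier] (hA : A.Idempotent) (h1 : A.OmitsType1)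
    (hmf : A.MajorityFree) :
    ∃ a ∈ reachable A, ∃ m : Term σ 3, ∀ k : A.carrier × A.carrier,
      A.tri m (a k) (a k.swap) (a k.swap) = a k ∧
      A.tri m (a k.swap) (a k.swap) (a k) = a k := by
  set P := squarePower A with hPdef
  have hfin : Finite P.carrier :=
    inferInstanceAs (Finite (A.carrier × A.carrier → A.carrier))
  have hP : P.Idempotent := Idempotent.pi fun _ => hA
  obtain ⟨_, ⟨a, ha, rfl⟩, hmin⟩ := (Set.toFinite
    ((fun u => P.ClosureSet {u, transpose u}) '' reachable A)).exists_minimal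
    ⟨_, fun k => k.1, fun _ => .refl, rfl⟩
  have hmin' : ∀ a' ∈ reachable A, a' ∈ P.ClosureSet {a, transpose a} →
      transpose a' ∈ P.ClosureSet {a, transpose a} →
      P.ClosureSet {a, transpose a} ⊆ P.ClosureSet {a', transpose a'} := fun a' ha' h h' =>
    hmin ⟨a', ha', rfl⟩ (closureSet_pair_subset (P.closureSet_isClosed _) h h')
  have hno : NoAbsorption P a (transpose a) := noAbsorption_of_minimal hA ha hmin'
  have hSL : ∀ s, A.IsPartialSL s → P.IsPartialSL s := by
    intro s hs x y
    constructor <;> funext k <;> simp only [P, (isHom_proj (fun _ => A) k).bin]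
    · exact (hs _ _).1
    · exact (hs _ _).2
  have hsep : ∀ x y : P.carrier, x ≠ y →
      ∃ p : P.carrier → A.carrier, IsHom P A p ∧ p x ≠ p y := by
    intro x y hxy
    obtain ⟨k, hk⟩ := Function.ne_iff.mp hxy
    exact ⟨fun u => u k, isHom_proj (fun _ => A) k, hk⟩
  obtain ⟨c, hc, hr⟩ := hno.exists_reach hA h1 hmf hP hsep hSL
  have hcr : c ∈ reachable A :=
    hr.mem_of_forall (fun u hu s hs z _ => bin_mem_reachable hA hs hu z) ha
  have hc' : transpose c ∈ forkCenter P a (transpose a) := by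
    have hr' := (hr.map (isHom_transpose A)).mono
      (E := P.ClosureSet {a, transpose a})
      (by rintro _ ⟨w, hw, rfl⟩; exact transpose_mem_closureSet hw)
    exact hr'.mem_of_forall
      (fun u hu s hs z hz => hno.bin_mem_forkCenter hP (hSL s hs) hu hz)
      (right_mem_forkCenter hP)
  have haB := left_mem_closureSet_pair (A := P) a (transpose a)
  have haC : a ∈ forkCenter P a (transpose a) :=
    closureSet_pair_subset (isClosed_forkCenter hP) hc hc' (hmin' c hcr hc.1 hc'.1 haB)
  obtain ⟨m, hm⟩ := (mem_closureSet_triple (A := prod P P)).mp (haC.2 a haB)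
  have hm' := (tri_prod_mk P P m _ _ _ _ _ _).symm.trans hm
  obtain ⟨e1, e2⟩ := Prod.mk.inj hm'
  refine ⟨a, ha, m, fun k => ⟨?_, ?_⟩⟩
  · exact ((isHom_proj (fun _ => A) k).tri m _ _ _).symm.trans (congrFun e1 k)
  · exact ((isHom_proj (fun _ => A) k).tri m _ _ _).symm.trans (congrFun e2 k)

end Square

end UAlgebra

/-- a uniform Mal'tsev operation for a smooth majority free
finite idempotent algebra omitting type 1: a single ternary term operation
`m` and a set `U` of Mal'tsev edges connecting any two distinct maximal
components, with `m` Mal'tsev on every pair in `U`. -/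
theorem stmt_14 (σ : Signature) (A : UAlgebra σ)
    (hfin : Finite A.carrier) (hne : Nonempty A.carrier) (hid : A.Idempotent)
    (hsm : A.IsSmooth) (h1 : A.OmitsType1) (hmf : A.MajorityFree) :
    ∃ (t : Term σ 3) (U : Set (A.carrier × A.carrier)),
      (∀ p ∈ U, IsMaltsevOn (fun x y z => t.eval A ![x, y, z]) {p.1, p.2}) ∧
      ∀ C1 C2 : Set A.carrier, A.IsMaxComponent C1 → A.IsMaxComponent C2 →
        C1 ≠ C2 → ∃ a ∈ C1, ∃ b ∈ C2, (a, b) ∈ U := by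
  obtain ⟨a, ha, m, hm⟩ := UAlgebra.exists_reachable_maltsev hid h1 hmf
  refine ⟨m, Set.range fun k => (a k, a k.swap), ?_, ?_⟩
  · rintro _ ⟨k, rfl⟩ x (rfl | rfl) y (rfl | rfl)
    · exact ⟨hid.tri_self m _, hid.tri_self m _⟩
    · exact hm k
    · exact hm k.swap
    · exact ⟨hid.tri_self m _, hid.tri_self m _⟩
  · rintro _ _ ⟨i, hi, rfl⟩ ⟨j, hj, rfl⟩ -
    exact ⟨a (i, j), ⟨ha (i, j), hi _ (ha (i, j))⟩, a (j, i), ⟨ha (j, i), hj _ (ha (j, i))⟩,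
      (i, j), rfl⟩
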